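/- arXiv:1902.03201 — 4 statements merged into one kernel-verified Lean document; each statement's English description precedes it below -/
import Mathlib

section
/- Every nonzero torsion abelian group A has, for some prime p, either a cyclic group ℤ/p^k or a Prüfer group ℤ(p^∞) as a direct summand; consequently A ⊗ ℤ_(p) ≠ 0 for that prime p. -/
open TensorProduct

instance spanIntPrime (p : ℕ) [hp : Fact p.Prime] : (Ideal.span {(p : ℤ)}).IsPrime :=
  (Ideal.span_singleton_prime (by exact_mod_cast hp.out.ne_zero)).mpr
    (Nat.prime_iff_prime_int.mp hp.out)

/-- `ℤ` localized at the prime `p`. -/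
noncomputable def ZLoc (p : ℕ) [Fact p.Prime] : Type :=
  Localization.AtPrime (Ideal.span {(p : ℤ)})

noncomputable instance (p : ℕ) [Fact p.Prime] : CommRing (ZLoc p) :=
  inferInstanceAs (CommRing (Localization.AtPrime (Ideal.span {(p : ℤ)})))

/-- The Prüfer `p`-group `ℤ(p^∞)`, realized as the `p`-primary component of `ℚ/ℤ`. -/
noncomputable def Prufer (p : ℕ) [Fact p.Prime] : Type :=
  AddCommGroup.primaryComponent (AddCircle (1 : ℚ)) p

noncomputable instance (p : ℕ) [Fact p.Prime] : AddCommGroup (Prufer p) :=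
  inferInstanceAs (AddCommGroup (AddCommGroup.primaryComponent (AddCircle (1 : ℚ)) p))

/-- If `f ∘ i` is injective with the same range as `f`, then `i` embeds `S` as a direct summand,
with complement `ker f`. -/
theorem exists_addEquiv_prod {S A Q : Type} [AddCommGroup S] [AddCommGroup A] [AddCommGroup Q]
    (i : S →+ A) (f : A →+ Q) (hinj : ∀ s, f (i s) = 0 → s = 0) (hran : ∀ a, ∃ s, f (i s) = f a) :
    ∃ (B : Type) (_ : AddCommGroup B), Nonempty (A ≃+ S × B) := by
  refine ⟨f.ker, inferInstance,
    ⟨(AddEquiv.ofBijective (i.coprod f.ker.subtype) ⟨?_, fun a ↦ ?_⟩).symm⟩⟩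
  · rw [injective_iff_map_eq_zero]
    rintro ⟨s, k, hk⟩ h
    have h' : i s + k = 0 := h
    have hs : s = 0 := hinj s <| by
      simpa [show f k = 0 from hk] using congrArg f h'
    subst hs
    simpa using h'
  · obtain ⟨s, hs⟩ := hran a
    exact ⟨(s, ⟨a - i s, by simp [AddMonoidHom.mem_ker, hs]⟩), by simp⟩

/-- An element killed by two coprime integers is zero. -/
theorem eq_zero_of_isCoprime_zsmul {A : Type} [AddCommGroup A] {m n : ℤ} (h : IsCoprime m n)
    {x : A} (hm : m • x = 0) (hn : n • x = 0) : x = 0 := by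
  obtain ⟨a, b, hab⟩ := h
  rw [← one_smul ℤ x, ← hab, add_smul, mul_smul, mul_smul, hm, hn, smul_zero, smul_zero, add_zero]

/-- A `p`-primary group on which `p` acts surjectively is divisible. -/
theorem surjective_zsmul_of_primary {G : Type} [AddCommGroup G] {p : ℕ} (hp : p.Prime)
    (hprim : ∀ x : G, ∃ k : ℕ, p ^ k • x = 0) (hdiv : ∀ x : G, ∃ y, p • y = x)
    {n : ℤ} (hn : n ≠ 0) : Function.Surjective (fun x : G ↦ n • x) := by
  have hpow : ∀ (k : ℕ) (x : G), ∃ y, ((p : ℤ) ^ k) • y = x := by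
    intro k
    induction k with
    | zero => exact fun x ↦ ⟨x, by simp⟩
    | succ k ih =>
      intro x
      obtain ⟨y, rfl⟩ := ih x
      obtain ⟨z, rfl⟩ := hdiv y
      exact ⟨z, by rw [pow_succ, mul_smul, natCast_zsmul]⟩
  intro x
  have hfin : FiniteMultiplicity (p : ℤ) n :=
    Int.finiteMultiplicity_iff.mpr ⟨by simpa using hp.ne_one, hn⟩
  obtain ⟨c, hc, hndvd⟩ := hfin.exists_eq_pow_mul_and_not_dvd
  obtain ⟨y, rfl⟩ := hpow (multiplicity (p : ℤ) n) x
  obtain ⟨k, hk⟩ := hprim y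
  obtain ⟨a, b, hab⟩ : IsCoprime c ((p : ℤ) ^ k) :=
    (((Nat.prime_iff_prime_int.mp hp).coprime_iff_not_dvd).mpr hndvd).symm.pow_right
  refine ⟨a • y, ?_⟩
  have hk' : ((p : ℤ) ^ k) • y = 0 := by exact_mod_cast hk
  have hy : (a * c) • y = y := by
    conv_rhs => rw [← one_smul ℤ y, ← hab, add_smul, mul_smul b, hk', smul_zero, add_zero]
  dsimp only
  calc n • a • y = (↑p ^ multiplicity (↑p) n * c) • a • y := by rw [← hc]
    _ = _ := by rw [mul_smul, ← mul_smul c, mul_comm c, hy]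

/-- A `p`-primary group on which `p` acts surjectively is injective. -/
theorem baer_of_primary {G : Type} [AddCommGroup G] {p : ℕ} (hp : p.Prime)
    (hprim : ∀ x : G, ∃ k : ℕ, p ^ k • x = 0) (hdiv : ∀ x : G, ∃ y, p • y = x) :
    Module.Baer ℤ G :=
  letI : DivisibleBy G ℤ :=
    divisibleByOfSMulRightSurj G ℤ (surjective_zsmul_of_primary hp hprim hdiv)
  Module.Baer.of_divisible G

/-- If `p` divides every `p`-primary element, the `p`-primary component is injective. -/
theorem baer_primaryComponent {A : Type} [AddCommGroup A] (p : ℕ) [hp : Fact p.Prime]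
    (hdiv : ∀ (x : A) (k : ℕ), p ^ k • x = 0 → ∃ y, p • y = x) :
    Module.Baer ℤ (AddCommGroup.primaryComponent A p) := by
  refine baer_of_primary hp.out (fun ⟨x, k, hk⟩ ↦ ⟨k, Subtype.ext hk⟩) ?_
  rintro ⟨x, k, hk⟩
  obtain ⟨y, rfl⟩ := hdiv x k hk
  exact ⟨⟨y, k + 1, by rwa [pow_succ, mul_smul]⟩, rfl⟩

theorem Prufer.baer (p : ℕ) [hp : Fact p.Prime] : Module.Baer ℤ (Prufer p) :=
  baer_primaryComponent p fun x _ _ ↦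
    ⟨DivisibleBy.div x (p : ℤ), by
      rw [← natCast_zsmul, DivisibleBy.div_cancel x (by exact_mod_cast hp.out.ne_zero)]⟩

/-- The `n`-torsion of `ℚ/ℤ` is generated by `1/n`. -/
theorem AddCircle.exists_zsmul_inv_eq {n : ℕ} (hn : n ≠ 0) {u : AddCircle (1 : ℚ)}
    (hu : n • u = 0) : ∃ m : ℤ, m • (((n : ℚ)⁻¹ : ℚ) : AddCircle (1 : ℚ)) = u := by
  induction u using QuotientAddGroup.induction_on with
  | H q =>
    obtain ⟨m, hm⟩ := (AddCircle.coe_eq_zero_iff (1 : ℚ) (x := n • q)).mp hu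
    refine ⟨m, ?_⟩
    have hn' : (n : ℚ) ≠ 0 := by exact_mod_cast hn
    have : m • (n : ℚ)⁻¹ = q := by
      simp only [zsmul_eq_mul, mul_one, nsmul_eq_mul] at hm ⊢
      rw [hm]
      field_simp
    rw [← this]
    rfl

theorem AddCircle.nsmul_inv {n : ℕ} (hn : n ≠ 0) :
    n • (((n : ℚ)⁻¹ : ℚ) : AddCircle (1 : ℚ)) = 0 := by
  rw [← AddCircle.coe_nsmul, AddCircle.coe_eq_zero_iff]
  exact ⟨1, by simp [hn]⟩

theorem isCoprime_of_zsmul_ne_zero {A : Type} [AddCommGroup A] {p k : ℕ} (hp : p.Prime)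
    {m : ℤ} {v : A} (hv : p ^ (k + 1) • v = 0) (hmv : p ^ k • m • v ≠ 0) :
    IsCoprime m ((p : ℤ) ^ (k + 1)) := by
  refine (((Nat.prime_iff_prime_int.mp hp).coprime_iff_not_dvd).mpr ?_).symm.pow_right
  rintro ⟨c, rfl⟩
  apply hmv
  rw [mul_comm, mul_smul, natCast_zsmul, smul_comm, ← mul_smul, ← pow_succ, hv, smul_zero]

/-- In `ℚ/ℤ`, an element of order `p ^ (k + 1)` generates the `p ^ (k + 1)`-torsion. -/
theorem AddCircle.exists_zsmul_eq {p k : ℕ} (hp : p.Prime) {u w : AddCircle (1 : ℚ)}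
    (hu : p ^ (k + 1) • u = 0) (hu' : p ^ k • u ≠ 0) (hw : p ^ (k + 1) • w = 0) :
    ∃ m : ℤ, m • u = w := by
  have hn : p ^ (k + 1) ≠ 0 := pow_ne_zero _ hp.ne_zero
  obtain ⟨m, rfl⟩ := AddCircle.exists_zsmul_inv_eq hn hu
  obtain ⟨l, rfl⟩ := AddCircle.exists_zsmul_inv_eq hn hw
  have hv := AddCircle.nsmul_inv hn
  obtain ⟨a, b, hab⟩ := isCoprime_of_zsmul_ne_zero hp hv hu'
  generalize ((((p ^ (k + 1) : ℕ) : ℚ)⁻¹ : ℚ) : AddCircle (1 : ℚ)) = v at *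
  have hv' : ((p : ℤ) ^ (k + 1)) • v = 0 := by exact_mod_cast hv
  refine ⟨l * a, ?_⟩
  rw [mul_smul, ← mul_smul a]
  congr 1
  conv_rhs => rw [← one_smul ℤ v, ← hab, add_smul, mul_smul b, hv', smul_zero, add_zero]

/-- An element `z` of `A` with `p ^ (k + 1) z = 0` and `p ^ k z ∉ p ^ (k + 1) A` generates a
direct summand. -/
theorem exists_zmod_summand {A : Type} [AddCommGroup A] {p k : ℕ} (hp : p.Prime) {z : A}
    (hz : p ^ (k + 1) • z = 0) (hz' : ∀ w : A, p ^ (k + 1) • w ≠ p ^ k • z) :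
    ∃ (B : Type) (_ : AddCommGroup B), Nonempty (A ≃+ ZMod (p ^ (k + 1)) × B) := by
  let N : AddSubgroup A := (nsmulAddMonoidHom (p ^ (k + 1)) : A →+ A).range
  have hne : QuotientAddGroup.mk' N (p ^ k • z) ≠ 0 := by
    intro h
    obtain ⟨w, hw⟩ := (QuotientAddGroup.eq_zero_iff _).mp h
    exact hz' w hw
  obtain ⟨c, hc⟩ := CharacterModule.exists_character_apply_ne_zero_of_ne_zero hne
  let f : A →+ AddCircle (1 : ℚ) := AddMonoidHom.comp c (QuotientAddGroup.mk' N)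
  have hf : ∀ a, p ^ (k + 1) • f a = 0 := by
    intro a
    rw [← map_nsmul]
    have : QuotientAddGroup.mk' N (p ^ (k + 1) • a) = 0 :=
      (QuotientAddGroup.eq_zero_iff _).mpr ⟨a, rfl⟩
    exact (congrArg c this).trans (map_zero c)
  have hfz : p ^ k • f z ≠ 0 := by
    rw [← map_nsmul]
    exact hc
  let i : ZMod (p ^ (k + 1)) →+ A :=
    ZMod.lift (p ^ (k + 1)) ⟨zmultiplesHom A z, by
      simpa only [zmultiplesHom_apply, natCast_zsmul] using hz⟩
  have hi : ∀ m : ℤ, i m = m • z := fun m ↦ by simp [i]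
  refine exists_addEquiv_prod i f (fun s hs ↦ ?_) fun a ↦ ?_
  · obtain ⟨m, rfl⟩ := ZMod.intCast_surjective s
    rw [hi, map_zsmul] at hs
    have : Fact p.Prime := ⟨hp⟩
    rw [ZMod.intCast_zmod_eq_zero_iff_dvd, ← addOrderOf_eq_prime_pow hfz (hf z)]
    exact addOrderOf_dvd_iff_zsmul_eq_zero.mpr hs
  · obtain ⟨m, hm⟩ := AddCircle.exists_zsmul_eq hp (hf z) hfz (hf a)
    exact ⟨m, by rw [hi, map_zsmul, hm]⟩

/-- If all `p`-torsion elements have infinite `p`-height, every `p`-primary element is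
divisible by `p`. -/
theorem exists_nsmul_eq_of_infinite_height {A : Type} [AddCommGroup A] {p : ℕ}
    (h : ∀ (x : A), p • x = 0 → ∀ n : ℕ, ∃ y, p ^ n • y = x) (k : ℕ) :
    ∀ (x : A), p ^ k • x = 0 → ∀ n : ℕ, ∃ y, p ^ n • y = x := by
  induction k with
  | zero => exact fun x hx n ↦ ⟨0, by simpa using hx.symm⟩
  | succ k ih =>
    intro x hx n
    obtain ⟨v, hv⟩ := h (p ^ k • x) (by rwa [← mul_smul, ← pow_succ']) (k + n)
    obtain ⟨w, hw⟩ := ih (x - p ^ n • v) (by rw [smul_sub, ← mul_smul, ← pow_add, hv, sub_self]) n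
    exact ⟨w + v, by rw [smul_add, hw, sub_add_cancel]⟩

theorem exists_prufer_summand {A : Type} [AddCommGroup A] (p : ℕ) [hp : Fact p.Prime]
    (hA : Module.Baer ℤ (AddCommGroup.primaryComponent A p)) {x : A} (hx : x ≠ 0)
    (hpx : p • x = 0) :
    ∃ (B : Type) (_ : AddCommGroup B), Nonempty (A ≃+ Prufer p × B) := by
  have hp0 := hp.out.ne_zero
  let e : Prufer p := ⟨(((p : ℚ)⁻¹ : ℚ) : AddCircle (1 : ℚ)), 1, by
    rw [pow_one]; exact AddCircle.nsmul_inv hp0⟩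
  have he : p • e = 0 := Subtype.ext (AddCircle.nsmul_inv hp0)
  have he0 : e ≠ 0 := by
    intro h
    obtain ⟨m, hm⟩ := (AddCircle.coe_eq_zero_iff (1 : ℚ)).mp (congrArg Subtype.val h)
    have hpq : (p : ℚ) ≠ 0 := by exact_mod_cast hp0
    have h1 : (m * p : ℚ) = 1 := by
      rw [zsmul_eq_mul, mul_one] at hm
      rw [hm, inv_mul_cancel₀ hpq]
    have h2 : m * (p : ℤ) = 1 := by exact_mod_cast h1
    exact (Nat.prime_iff_prime_int.mp hp.out).not_isUnit (IsUnit.of_mul_eq_one_right m h2)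
  have hsocle : ∀ u : Prufer p, p • u = 0 → ∃ m : ℤ, m • e = u := by
    intro u hu
    obtain ⟨m, hm⟩ := AddCircle.exists_zsmul_inv_eq hp0 (congrArg Subtype.val hu)
    exact ⟨m, Subtype.ext hm⟩
  have hdvd : ∀ {G : Type} [AddCommGroup G] {g : G}, g ≠ 0 → p • g = 0 → ∀ m : ℤ, m • g = 0 →
      (p : ℤ) ∣ m := by
    intro G _ g hg hpg m hm
    by_contra h
    exact hg (eq_zero_of_isCoprime_zsmul
      (((Nat.prime_iff_prime_int.mp hp.out).coprime_iff_not_dvd).mpr h)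
      (by rwa [natCast_zsmul]) hm)
  let j : ZMod p →+ Prufer p :=
    ZMod.lift p ⟨zmultiplesHom _ e, by simpa only [zmultiplesHom_apply, natCast_zsmul] using he⟩
  let x' : AddCommGroup.primaryComponent A p := ⟨x, 1, by rwa [pow_one]⟩
  let l : ZMod p →+ AddCommGroup.primaryComponent A p :=
    ZMod.lift p ⟨zmultiplesHom _ x', by
      simpa only [zmultiplesHom_apply, natCast_zsmul] using Subtype.ext hpx⟩
  have hj : ∀ m : ℤ, j m = m • e := fun m ↦ by simp [j]
  have hl : ∀ m : ℤ, l m = m • x' := fun m ↦ by simp [l]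
  have hjinj : Function.Injective j := by
    rw [injective_iff_map_eq_zero]
    intro s hs
    obtain ⟨m, rfl⟩ := ZMod.intCast_surjective s
    rw [hj] at hs
    exact (ZMod.intCast_zmod_eq_zero_iff_dvd _ _).mpr (hdvd he0 he m hs)
  obtain ⟨g, hg⟩ := hA.extension_property_addMonoidHom j hjinj l
  have hge : g e = x' := by
    have := DFunLike.congr_fun hg ((1 : ℤ) : ZMod p)
    rwa [AddMonoidHom.comp_apply, hj, hl, one_smul, one_smul] at this
  have hx0 : x' ≠ 0 := fun h ↦ hx (congrArg Subtype.val h)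
  have hker : ∀ (k : ℕ) (u : Prufer p), p ^ k • u = 0 → g u = 0 → u = 0 := by
    intro k
    induction k with
    | zero => exact fun u hu _ ↦ by simpa using hu
    | succ k ih =>
      intro u hu hgu
      have hpu : p • u = 0 :=
        ih (p • u) (by rwa [← mul_smul, ← pow_succ]) (by rw [map_nsmul, hgu, smul_zero])
      obtain ⟨m, rfl⟩ := hsocle u hpu
      rw [map_zsmul, hge] at hgu
      obtain ⟨c, rfl⟩ := hdvd hx0 (Subtype.ext hpx) m hgu
      rw [mul_comm, mul_smul, natCast_zsmul, he, smul_zero]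
  let i : Prufer p →+ A := (AddCommGroup.primaryComponent A p).subtype.comp g
  have hi : Function.Injective i := by
    rw [injective_iff_map_eq_zero]
    intro u hu
    obtain ⟨k, hk⟩ := u.2
    exact hker k u (Subtype.ext hk) (Subtype.ext hu)
  obtain ⟨r, hr⟩ := (Prufer.baer p).extension_property_addMonoidHom i hi (AddMonoidHom.id _)
  have hri : ∀ u, r (i u) = u := DFunLike.congr_fun hr
  exact exists_addEquiv_prod i r (fun s hs ↦ by rwa [hri] at hs) fun a ↦ ⟨r a, hri _⟩

/-- A group with nontrivial `p`-torsion has nontrivial localization at `p`. -/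
theorem nontrivial_tensor_ZLoc {A : Type} [AddCommGroup A] (p : ℕ) [hp : Fact p.Prime] {x : A}
    (hx : x ≠ 0) (hpx : p • x = 0) : Nontrivial (A ⊗[ℤ] ZLoc p) := by
  let S := (Ideal.span {(p : ℤ)}).primeCompl
  have : IsLocalization S (ZLoc p) := by
    convert! (inferInstance : IsLocalization S (Localization S))
    exact Subsingleton.elim (α := Algebra ℤ (ZLoc p)) _ _
  have hone : TensorProduct.mk ℤ (ZLoc p) A 1 x ≠ 0 := by
    intro h
    obtain ⟨⟨s, hs⟩, hsx⟩ := (IsLocalizedModule.eq_zero_iff S _).mp h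
    refine hx (eq_zero_of_isCoprime_zsmul (m := p) (n := s)
      (((Nat.prime_iff_prime_int.mp hp.out).coprime_iff_not_dvd).mpr fun h ↦ hs ?_)
      (by rwa [natCast_zsmul]) hsx)
    exact Ideal.mem_span_singleton.mpr h
  have : Nontrivial (ZLoc p ⊗[ℤ] A) := nontrivial_of_ne _ _ hone
  exact (TensorProduct.comm ℤ A (ZLoc p)).toEquiv.nontrivial

/-- Every nonzero torsion abelian group `A` has, for some prime `p`,
either a cyclic group `ℤ/p^k` or a Prüfer group `ℤ(p^∞)` as a direct summand;
consequently `A ⊗ ℤ_(p) ≠ 0` for that prime. -/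
theorem stmt5 (A : Type) [AddCommGroup A] [Nontrivial A]
    (htor : ∀ x : A, ∃ n : ℕ, 0 < n ∧ n • x = 0) :
    ∃ (p : ℕ) (_ : Fact p.Prime),
      ((∃ (k : ℕ) (_ : 1 ≤ k) (B : Type) (_ : AddCommGroup B),
          Nonempty (A ≃+ ZMod (p ^ k) × B)) ∨
        (∃ (B : Type) (_ : AddCommGroup B), Nonempty (A ≃+ Prufer p × B))) ∧
      Nontrivial (A ⊗[ℤ] ZLoc p) := by
  obtain ⟨y, hy⟩ := exists_ne (0 : A)
  obtain ⟨n, hn, hny⟩ := htor y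
  obtain ⟨p, hp, x, hx, hpx⟩ : ∃ (p : ℕ) (_ : p.Prime) (x : A), x ≠ 0 ∧ p • x = 0 := by
    have hfin : IsOfFinAddOrder y := isOfFinAddOrder_iff_nsmul_eq_zero.mpr ⟨n, hn, hny⟩
    have h1 : addOrderOf y ≠ 1 := fun h ↦ hy (AddMonoid.addOrderOf_eq_one_iff.mp h)
    obtain ⟨c, hc⟩ := Nat.minFac_dvd (addOrderOf y)
    have hprime := Nat.minFac_prime h1
    have hpos := hfin.addOrderOf_pos
    generalize (addOrderOf y).minFac = p at hc hprime
    refine ⟨p, hprime, c • y, fun h ↦ ?_, ?_⟩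
    · have hc0 : 0 < c := Nat.pos_of_ne_zero fun h0 ↦
        hpos.ne' (by rw [hc, h0, mul_zero])
      have := Nat.le_of_dvd hc0 (addOrderOf_dvd_of_nsmul_eq_zero h)
      have := hprime.two_le
      nlinarith
    · rw [← mul_smul, ← hc, addOrderOf_nsmul_eq_zero]
  have : Fact p.Prime := ⟨hp⟩
  refine ⟨p, ⟨hp⟩, ?_, nontrivial_tensor_ZLoc p hx hpx⟩
  by_cases h : ∀ x : A, p • x = 0 → ∀ n : ℕ, ∃ y, p ^ n • y = x
  · refine Or.inr (exists_prufer_summand p (baer_primaryComponent p fun u k hk ↦ ?_) hx hpx)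
    simpa using exists_nsmul_eq_of_infinite_height h k u hk 1
  · push Not at h
    obtain ⟨u, hu, hex⟩ := h
    classical
    obtain ⟨k, hk⟩ : ∃ k, Nat.find hex = k + 1 := Nat.exists_eq_succ_of_ne_zero fun h0 ↦ by
      have := Nat.find_spec hex
      rw [h0] at this
      exact this u (by simp)
    have hspec := Nat.find_spec hex
    have hmin := Nat.find_min hex (m := k) (by omega)
    rw [hk] at hspec
    push Not at hmin
    obtain ⟨z, rfl⟩ := hmin
    refine Or.inl ⟨k + 1, by omega, exists_zmod_summand hp ?_ hspec⟩
    rwa [pow_succ', mul_smul]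
end

section
/- For any geometrically finite group Γ and any field k, cd_k(Γ × Γ) = 2 · cd_k(Γ). -/
open Finset

universe u

/-- The integers as the trivial module over the group ring `ℤΓ`. -/
noncomputable abbrev TrivialZ (Γ : Type) [Group Γ] : Type :=
  (Representation.trivial ℤ (G := Γ) (V := ℤ)).asModule

/-- A group `Γ` is of finite type (type `FP_∞`) if the trivial `ℤΓ`-module `ℤ` admits a
resolution by finitely generated free `ℤΓ`-modules. -/
def HasFiniteType (Γ : Type) [Group Γ] : Prop :=
  ∃ (C : ℕ → Type) (_ : ∀ n, AddCommGroup (C n))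
    (_ : ∀ n, Module (MonoidAlgebra ℤ Γ) (C n)),
    (∀ n, Module.Free (MonoidAlgebra ℤ Γ) (C n)) ∧
    (∀ n, Module.Finite (MonoidAlgebra ℤ Γ) (C n)) ∧
    ∃ (d : ∀ n, C (n + 1) →ₗ[MonoidAlgebra ℤ Γ] C n)
      (ε : C 0 →ₗ[MonoidAlgebra ℤ Γ] TrivialZ Γ),
      Function.Surjective ε ∧
      LinearMap.range (d 0) = LinearMap.ker ε ∧
      ∀ n, LinearMap.range (d (n + 1)) = LinearMap.ker (d n)

/-- A group `Γ` is geometrically finite (type `FL`) if the trivial `ℤΓ`-module `ℤ` admits a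
finite-length resolution by finitely generated free `ℤΓ`-modules. -/
def IsGeomFinite (Γ : Type) [Group Γ] : Prop :=
  ∃ (N : ℕ) (C : ℕ → Type) (_ : ∀ n, AddCommGroup (C n))
    (_ : ∀ n, Module (MonoidAlgebra ℤ Γ) (C n)),
    (∀ n, Module.Free (MonoidAlgebra ℤ Γ) (C n)) ∧
    (∀ n, Module.Finite (MonoidAlgebra ℤ Γ) (C n)) ∧
    (∀ n, N < n → Subsingleton (C n)) ∧
    ∃ (d : ∀ n, C (n + 1) →ₗ[MonoidAlgebra ℤ Γ] C n)
      (ε : C 0 →ₗ[MonoidAlgebra ℤ Γ] TrivialZ Γ),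
      Function.Surjective ε ∧
      LinearMap.range (d 0) = LinearMap.ker ε ∧
      ∀ n, LinearMap.range (d (n + 1)) = LinearMap.ker (d n)

/-- The cohomological dimension of `Γ` over the ring `R`: the supremum (in `ℕ∞`) of
the degrees `n` with `Hⁿ(Γ, M) ≠ 0` for some `RΓ`-module `M`. -/
noncomputable def cohDim (R : Type) [CommRing R] (Γ : Type) [Group Γ] : ℕ∞ :=
  sSup {e : ℕ∞ | ∃ (n : ℕ) (M : Rep R Γ), e = n ∧ Nontrivial (groupCohomology M n)}

section

open CategoryTheory TensorProduct

namespace Rep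

section Exact

variable {k G : Type} [Field k] [Group G]

/-- A short complex of representations is short exact iff the underlying sequence of vector
spaces is. -/
theorem shortExact_iff (S : ShortComplex (Rep.{0} k G)) :
    S.ShortExact ↔ Function.Injective S.f.hom ∧ Function.Exact S.f.hom S.g.hom ∧
      Function.Surjective S.g.hom := by
  have hex : S.Exact ↔ Function.Exact S.f.hom S.g.hom := by
    rw [← ShortComplex.exact_map_iff_of_faithful S (forget₂ (Rep.{0} k G) (ModuleCat k)),
      ShortComplex.ShortExact.moduleCat_exact_iff_function_exact]
    rfl
  rw [← mono_iff_injective, ← epi_iff_surjective, ← hex]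
  exact ⟨fun h ↦ ⟨h.mono_f, h.exact, h.epi_g⟩,
    fun h ↦ { exact := h.2.1, mono_f := h.1, epi_g := h.2.2 }⟩

/-- Every representation is the last term of a short exact sequence with projective middle
term. -/
theorem exists_shortExact_projective (X : Rep.{0} k G) :
    ∃ S : ShortComplex (Rep.{0} k G), S.ShortExact ∧ Projective S.X₂ ∧ S.X₃ = X := by
  let S := ShortComplex.mk (Limits.kernel.ι (Projective.π X)) (Projective.π X) (by simp)
  have hS : S.Exact := S.exact_of_f_is_kernel (Limits.kernelIsKernel _)
  have hf : Mono S.f := inferInstanceAs (Mono (Limits.kernel.ι _))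
  have hg : Epi S.g := inferInstanceAs (Epi (Projective.π X))
  have hS' : S.ShortExact := { exact := hS }
  exact ⟨S, hS', inferInstanceAs (Projective (Projective.over X)), rfl⟩

end Exact

section ExternalTensor

variable {k G H : Type} [Field k] [Group G] [Group H]

/-- The external tensor product `X ⊠ Y` of a representation of `G` and one of `H`. -/
noncomputable abbrev extTensor (X : Rep.{0} k G) (Y : Rep.{0} k H) : Rep.{0} k (G × H) :=
  Rep.of (Representation.tprod (X.ρ.comp (MonoidHom.fst G H)) (Y.ρ.comp (MonoidHom.snd G H)))

theorem extTensor_ρ_tmul (X : Rep.{0} k G) (Y : Rep.{0} k H) (g : G × H) (x : X.V) (y : Y.V) :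
    (extTensor X Y).ρ g (x ⊗ₜ[k] y) = X.ρ g.1 x ⊗ₜ[k] Y.ρ g.2 y := rfl

/-- The functor `X ⊠ -`. -/
noncomputable def extTensorLeft (X : Rep.{0} k G) : Rep.{0} k H ⥤ Rep.{0} k (G × H) where
  obj Y := extTensor X Y
  map f := Rep.ofHom ⟨f.hom.toLinearMap.lTensor X.V, fun g ↦ by
    ext x y
    simp [Rep.hom_comm_apply]⟩
  map_id Y := by ext; simp
  map_comp f g := by ext; simp

/-- The functor `- ⊠ Y`. -/
noncomputable def extTensorRight (Y : Rep.{0} k H) : Rep.{0} k G ⥤ Rep.{0} k (G × H) where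
  obj X := extTensor X Y
  map f := Rep.ofHom ⟨f.hom.toLinearMap.rTensor Y.V, fun g ↦ by
    ext x y
    simp [Rep.hom_comm_apply]⟩
  map_id X := by ext; simp
  map_comp f g := by ext; simp

theorem extTensor_hom_ext {X : Rep.{0} k G} {Y : Rep.{0} k H} {Z : Rep.{0} k (G × H)}
    {f g : extTensor X Y ⟶ Z} (h : ∀ x y, f.hom (x ⊗ₜ[k] y) = g.hom (x ⊗ₜ[k] y)) : f = g := by
  ext x y
  exact h x y

instance (X : Rep.{0} k G) : (extTensorLeft (H := H) X).Additive where
  map_add {_ _ f g} := extTensor_hom_ext fun x y ↦ tmul_add x (f.hom y) (g.hom y)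

instance (Y : Rep.{0} k H) : (extTensorRight (G := G) Y).Additive where
  map_add {_ _ f g} := extTensor_hom_ext fun x y ↦ add_tmul (f.hom x) (g.hom x) y

theorem extTensorLeft_shortExact (X : Rep.{0} k G) {S : ShortComplex (Rep.{0} k H)}
    (hS : S.ShortExact) : (S.map (extTensorLeft X)).ShortExact := by
  rw [shortExact_iff] at hS ⊢
  exact ⟨Module.Flat.lTensor_preserves_injective_linearMap (M := X.V) S.f.hom.toLinearMap hS.1,
    Module.Flat.lTensor_exact (f := S.f.hom.toLinearMap) (g := S.g.hom.toLinearMap) X.V hS.2.1,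
    LinearMap.lTensor_surjective (g := S.g.hom.toLinearMap) X.V hS.2.2⟩

theorem extTensorRight_shortExact (Y : Rep.{0} k H) {S : ShortComplex (Rep.{0} k G)}
    (hS : S.ShortExact) : (S.map (extTensorRight Y)).ShortExact := by
  rw [shortExact_iff] at hS ⊢
  exact ⟨Module.Flat.rTensor_preserves_injective_linearMap (M := Y.V) S.f.hom.toLinearMap hS.1,
    Module.Flat.rTensor_exact (f := S.f.hom.toLinearMap) (g := S.g.hom.toLinearMap) Y.V hS.2.1,
    LinearMap.rTensor_surjective (g := S.g.hom.toLinearMap) Y.V hS.2.2⟩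

/-- For a representation `Y` of `H` and a representation `M` of `G × H`, the action of `G` on `M`
by `H`-equivariant maps. -/
noncomputable def leftAction (M : Rep.{0} k (G × H)) (g : G) :
    Rep.res (MonoidHom.inr G H) M ⟶ Rep.res (MonoidHom.inr G H) M :=
  Rep.ofHom ⟨M.ρ (g, 1), fun h ↦ by
    ext y
    simp [← Module.End.mul_apply, ← map_mul]⟩

/-- For a representation `Y` of `H` and a representation `M` of `G × H`, the space of
`H`-equivariant maps `Y → M`, as a representation of `G`. -/
noncomputable def equivariantHom (Y : Rep.{0} k H) (M : Rep.{0} k (G × H)) : Rep.{0} k G :=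
  Rep.of (X := Y ⟶ Rep.res (MonoidHom.inr G H) M)
    { toFun g := (CategoryTheory.Linear.rightComp k Y (leftAction M g))
      map_one' := by
        refine LinearMap.ext fun f ↦ ?_
        ext y
        change M.ρ 1 (f.hom y) = f.hom y
        simp
      map_mul' g g' := by
        refine LinearMap.ext fun f ↦ ?_
        ext y
        change M.ρ (g * g', 1) (f.hom y) = M.ρ (g, 1) (M.ρ (g', 1) (f.hom y))
        simp [← Module.End.mul_apply, ← map_mul] }

theorem equivariantHom_ρ_apply (Y : Rep.{0} k H) (M : Rep.{0} k (G × H)) (g : G)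
    (f : Y ⟶ Rep.res (MonoidHom.inr G H) M) (y : Y.V) :
    (show Y ⟶ Rep.res (MonoidHom.inr G H) M from (equivariantHom Y M).ρ g f).hom y =
      M.ρ (g, 1) (f.hom y) := rfl

/-- Postcomposition on spaces of equivariant maps. -/
noncomputable def equivariantHomMap (Y : Rep.{0} k H) {M M' : Rep.{0} k (G × H)} (e : M ⟶ M') :
    equivariantHom (G := G) Y M ⟶ equivariantHom Y M' :=
  Rep.ofHom ⟨CategoryTheory.Linear.rightComp k Y ((Rep.resFunctor (MonoidHom.inr G H)).map e),
    fun g ↦ by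
      refine LinearMap.ext fun f ↦ ?_
      refine Rep.hom_ext (Representation.IntertwiningMap.ext (LinearMap.ext fun y ↦ ?_))
      exact Rep.hom_comm_apply e (g, 1) ((show Y ⟶ Rep.res (MonoidHom.inr G H) M from f).hom y)⟩

/-- Morphisms `X ⊠ Y ⟶ M` as morphisms `X ⟶ Hom_H(Y, M)`. -/
noncomputable def extTensorCurry {X : Rep.{0} k G} {Y : Rep.{0} k H} {M : Rep.{0} k (G × H)}
    (f : extTensor X Y ⟶ M) : X ⟶ equivariantHom Y M :=
  Rep.ofHom ⟨
    { toFun x := Rep.ofHom ⟨TensorProduct.curry f.hom.toLinearMap x, fun h ↦ by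
        ext y
        simpa [extTensor_ρ_tmul] using Rep.hom_comm_apply f (1, h) (x ⊗ₜ y)⟩
      map_add' x x' := by
        refine Rep.hom_ext (Representation.IntertwiningMap.ext (LinearMap.ext fun y ↦ ?_))
        exact (congrArg f.hom (add_tmul x x' y)).trans (map_add f.hom _ _)
      map_smul' c x := by
        refine Rep.hom_ext (Representation.IntertwiningMap.ext (LinearMap.ext fun y ↦ ?_))
        exact map_smul f.hom c (x ⊗ₜ[k] y) },
    fun g ↦ by
      refine LinearMap.ext fun x ↦ ?_
      refine Rep.hom_ext (Representation.IntertwiningMap.ext (LinearMap.ext fun y ↦ ?_))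
      have h := Rep.hom_comm_apply f (g, 1) (x ⊗ₜ y)
      rw [extTensor_ρ_tmul, map_one] at h
      exact h⟩

/-- Morphisms `X ⟶ Hom_H(Y, M)` as morphisms `X ⊠ Y ⟶ M`. -/
noncomputable def extTensorUncurry {X : Rep.{0} k G} {Y : Rep.{0} k H} {M : Rep.{0} k (G × H)}
    (f : X ⟶ equivariantHom Y M) : extTensor X Y ⟶ M :=
  Rep.ofHom ⟨TensorProduct.lift (LinearMap.mk₂ k
      (fun x y ↦ (show Y ⟶ Rep.res (MonoidHom.inr G H) M from f.hom x).hom y)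
      (fun x x' y ↦ by rw [map_add]; rfl)
      (fun c x y ↦ by rw [map_smul]; rfl)
      (fun x y y' ↦ map_add _ _ _)
      (fun c x y ↦ map_smul _ _ _)), fun g ↦ by
    ext x y
    have h1 := Rep.hom_comm_apply f g.1 x
    have h2 := Rep.hom_comm_apply (show Y ⟶ Rep.res (MonoidHom.inr G H) M from f.hom x) g.2 y
    change (show Y ⟶ Rep.res (MonoidHom.inr G H) M from f.hom (X.ρ g.1 x)).hom (Y.ρ g.2 y) =
      M.ρ g ((show Y ⟶ Rep.res (MonoidHom.inr G H) M from f.hom x).hom y)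
    rw [h1]
    refine (equivariantHom_ρ_apply Y M g.1 _ _).trans ?_
    refine (congrArg (M.ρ (g.1, 1)) h2).trans ?_
    change (M.ρ (g.1, 1) * M.ρ (1, g.2)) _ = _
    rw [← map_mul]
    simp⟩

theorem projective_extTensor (P : Rep.{0} k G) (Q : Rep.{0} k H) [Projective P] [Projective Q] :
    Projective (extTensor P Q) where
  factors {M' M} f e _ := by
    have he : Epi ((Rep.resFunctor (MonoidHom.inr G H)).map e) := by
      rw [epi_iff_surjective]
      exact (epi_iff_surjective e).1 inferInstance
    have : Epi (equivariantHomMap (G := G) Q e) := by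
      rw [epi_iff_surjective]
      intro f
      exact ⟨_, Projective.factorThru_comp (show Q ⟶ Rep.res (MonoidHom.inr G H) M from f)
        ((Rep.resFunctor (MonoidHom.inr G H)).map e)⟩
    refine ⟨extTensorUncurry (Projective.factorThru (extTensorCurry f) (equivariantHomMap Q e)),
      extTensor_hom_ext fun x y ↦ ?_⟩
    have h := congrArg (fun φ : P ⟶ equivariantHom Q M ↦ φ.hom x)
      (Projective.factorThru_comp (extTensorCurry f) (equivariantHomMap Q e))
    exact congrArg (fun φ : Q ⟶ Rep.res (MonoidHom.inr G H) M ↦ φ.hom y) h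

end ExternalTensor
end Rep

namespace CategoryTheory.ShortComplex.ShortExact

open Abelian

universe v

/-- Let `φ : S₂ ⟶ S₃` be a morphism of short exact sequences whose component `φ.τ₃` is a
monomorphism with cokernel of projective dimension `≤ 1`, and such that `S₃.X₂` is projective.
Then the identity of `S₂.X₁` is the sum of a map factoring through `S₂.f` and a map factoring
through `φ.τ₁`. -/
theorem exists_id_eq_comp_add_comp {C : Type u} [Category.{v} C] [Abelian C]
    {S₂ S₃ : ShortComplex C} (h₂ : S₂.ShortExact) (h₃ : S₃.ShortExact) (φ : S₂ ⟶ S₃)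
    {W : C} {p : S₃.X₃ ⟶ W} {w : φ.τ₃ ≫ p = 0} (h₁ : (ShortComplex.mk φ.τ₃ p w).ShortExact)
    [HasProjectiveDimensionLT W 2] [Projective S₃.X₂] :
    ∃ (u : S₂.X₂ ⟶ S₂.X₁) (v : S₃.X₁ ⟶ S₂.X₁), 𝟙 S₂.X₁ = S₂.f ≫ u + φ.τ₁ ≫ v := by
  let := HasExt.standard C
  obtain ⟨y, hy⟩ := Ext.contravariant_sequence_exact₁ h₁ S₂.X₁ (n₁ := 2) h₂.extClass rfl
    (Ext.eq_zero_of_hasProjectiveDimensionLT _ 2 le_rfl)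
  obtain ⟨v, hv⟩ := Ext.contravariant_sequence_exact₃ h₃ S₂.X₁ y
    (Ext.eq_zero_of_hasProjectiveDimensionLT _ 1 le_rfl) (n₀ := 0) rfl
  obtain ⟨v, rfl⟩ := Ext.homEquiv₀.symm.surjective v
  obtain ⟨u, hu⟩ := Ext.contravariant_sequence_exact₁ h₂ S₂.X₁ (n₁ := 1)
    (Ext.mk₀ (𝟙 S₂.X₁ - φ.τ₁ ≫ v)) rfl (by
      have hsub : Ext.mk₀ (𝟙 S₂.X₁ - φ.τ₁ ≫ v) = Ext.mk₀ (𝟙 S₂.X₁) - Ext.mk₀ (φ.τ₁ ≫ v) :=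
        map_sub Ext.addEquiv₀.symm _ _
      have hv' : h₃.extClass.comp (Ext.mk₀ v) (add_zero 1) = y := hv
      have hy' : (Ext.mk₀ φ.τ₃).comp y (zero_add 1) = h₂.extClass := hy
      rw [hsub, sub_eq_add_neg, Ext.comp_add, Ext.comp_neg, Ext.comp_mk₀_id, ← sub_eq_add_neg,
        sub_eq_zero, ← Ext.mk₀_comp_mk₀,
        ← Ext.comp_assoc _ _ _ (add_zero 1) (add_zero 0) (by simp), extClass_naturality h₂ h₃ φ,
        Ext.comp_assoc _ _ _ (zero_add 1) (add_zero 1) (by simp), hv', hy'])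
  obtain ⟨u, rfl⟩ := Ext.homEquiv₀.symm.surjective u
  refine ⟨u, v, ?_⟩
  rw [← sub_eq_iff_eq_add]
  apply Ext.homEquiv₀.symm.injective
  simpa using hu.symm

end CategoryTheory.ShortComplex.ShortExact

namespace Rep

variable {k G H : Type} [Field k] [Group G] [Group H]

theorem isZero_extTensor_left {X : Rep.{0} k G} (hX : Limits.IsZero X) (Y : Rep.{0} k H) :
    Limits.IsZero (extTensor X Y) :=
  (extTensorRight Y).map_isZero hX

theorem isZero_extTensor_right (X : Rep.{0} k G) {Y : Rep.{0} k H} (hY : Limits.IsZero Y) :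
    Limits.IsZero (extTensor X Y) :=
  (extTensorLeft X).map_isZero hY

theorem hasProjectiveDimensionLT_extTensor_of_projective (P : Rep.{0} k G) [Projective P] (m : ℕ)
    (Y : Rep.{0} k H) [HasProjectiveDimensionLT Y m] :
    HasProjectiveDimensionLT (extTensor P Y) m := by
  induction m using Nat.twoStepInduction generalizing Y with
  | zero =>
    rw [hasProjectiveDimensionLT_zero_iff_isZero] at *
    exact isZero_extTensor_right P ‹_›
  | one =>
    rw [← projective_iff_hasProjectiveDimensionLT_one] at *
    exact projective_extTensor P Y
  | more m _ ih =>
    obtain ⟨S, hS, hP, rfl⟩ := exists_shortExact_projective Y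
    have := (hS.hasProjectiveDimensionLT_X₃_iff m hP).1 ‹_›
    exact ((extTensorLeft_shortExact P hS).hasProjectiveDimensionLT_X₃_iff m
      (projective_extTensor P S.X₂)).2 (ih S.X₁)

theorem hasProjectiveDimensionLT_extTensor (n m : ℕ) (X : Rep.{0} k G) (Y : Rep.{0} k H)
    [HasProjectiveDimensionLT X n] [HasProjectiveDimensionLT Y (m + 1)] :
    HasProjectiveDimensionLT (extTensor X Y) (n + m) := by
  induction n using Nat.twoStepInduction generalizing X with
  | zero =>
    have : HasProjectiveDimensionLT (extTensor X Y) 0 := by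
      rw [hasProjectiveDimensionLT_zero_iff_isZero] at *
      exact isZero_extTensor_left ‹_› Y
    infer_instance
  | one =>
    rw [← projective_iff_hasProjectiveDimensionLT_one] at *
    rw [add_comm]
    exact hasProjectiveDimensionLT_extTensor_of_projective X (m + 1) Y
  | more n _ ih =>
    obtain ⟨S, hS, hP, rfl⟩ := exists_shortExact_projective X
    have := (hS.hasProjectiveDimensionLT_X₃_iff n hP).1 ‹_›
    have h₁ := ih S.X₁
    have h₂ := hasProjectiveDimensionLT_extTensor_of_projective S.X₂ (m + 1) Y
    have h₂' := hasProjectiveDimensionLT_of_ge (extTensor S.X₂ Y) (m + 1) (n + 1 + m + 1)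
      (by lia)
    have := (extTensorRight_shortExact Y hS).hasProjectiveDimensionLT_X₃ (n + 1 + m) h₁ h₂'
    rwa [show n + 2 + m = n + 1 + m + 1 by lia]

end Rep

namespace Rep

variable {k G H : Type} [Field k] [Group G] [Group H]

/-- A representation is finitely generated if it is spanned by the orbits of finitely many
vectors. -/
def IsFG (L : Rep.{0} k G) : Prop :=
  ∃ s : Finset L.V, ∀ W : Submodule k L.V, (∀ g, ∀ x ∈ W, L.ρ g x ∈ W) → (s : Set L.V) ⊆ W → W = ⊤

/-- The contraction `V ⊗ L → L` along a linear form on `V`. -/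
noncomputable def contractLeft {V : Type} [AddCommGroup V] [Module k V] (L : Type)
    [AddCommGroup L] [Module k L] (α : Module.Dual k V) : V ⊗[k] L →ₗ[k] L :=
  (TensorProduct.lid k L).toLinearMap ∘ₗ α.rTensor L

theorem contractLeft_tmul {V : Type} [AddCommGroup V] [Module k V] {L : Type}
    [AddCommGroup L] [Module k L] (α : Module.Dual k V) (x : V) (y : L) :
    contractLeft L α (x ⊗ₜ[k] y) = α x • y := rfl

/-- An equivariant map from a finitely generated representation `L` to `V ⊗ L` takes values in
`V₀ ⊗ L` for some finite-dimensional `V₀ ≤ V`. -/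
theorem IsFG.exists_range_le {L : Rep.{0} k G} (hL : L.IsFG) {V : Type} [AddCommGroup V]
    [Module k V] (f : L.V →ₗ[k] V ⊗[k] L.V)
    (hf : ∀ g x, f (L.ρ g x) = (L.ρ g).lTensor V (f x)) :
    ∃ V₀ : Submodule k V, Module.Finite k V₀ ∧
      LinearMap.range f ≤ LinearMap.range (V₀.subtype.rTensor L.V) := by
  obtain ⟨s, hs⟩ := hL
  obtain ⟨V₀, hV₀, h⟩ := TensorProduct.exists_finite_submodule_left_of_setFinite (f '' s)
    (s.finite_toSet.image f)
  refine ⟨V₀, hV₀, ?_⟩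
  rw [LinearMap.range_eq_map, Submodule.map_le_iff_le_comap, top_le_iff]
  refine hs _ (fun g x hx ↦ ?_) fun x hx ↦ h ⟨x, hx, rfl⟩
  obtain ⟨y, hy⟩ := hx
  refine ⟨(L.ρ g).lTensor V₀ y, ?_⟩
  rw [hf, ← hy, ← LinearMap.comp_apply, ← LinearMap.comp_apply, LinearMap.rTensor_comp_lTensor,
    LinearMap.lTensor_comp_rTensor]

theorem IsFG.exists_dual_eq {L : Rep.{0} k G} (hL : L.IsFG) {V : Type} [AddCommGroup V]
    [Module k V] (f : L.V →ₗ[k] V ⊗[k] L.V)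
    (hf : ∀ g x, f (L.ρ g x) = (L.ρ g).lTensor V (f x)) (θ : Module.Dual k (L.V →ₗ[k] L.V)) :
    ∃ a : V, ∀ α : Module.Dual k V, α a = θ (contractLeft L.V α ∘ₗ f) := by
  obtain ⟨V₀, hV₀, hr⟩ := hL.exists_range_le f hf
  have hinj : Function.Injective (V₀.subtype.rTensor L.V) :=
    Module.Flat.rTensor_preserves_injective_linearMap _ V₀.injective_subtype
  obtain ⟨f₀, hf₀⟩ : ∃ f₀ : L.V →ₗ[k] V₀ ⊗[k] L.V, V₀.subtype.rTensor L.V ∘ₗ f₀ = f := by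
    let e := LinearEquiv.ofInjective _ hinj
    refine ⟨e.symm.toLinearMap ∘ₗ f.codRestrict _ fun x ↦ hr ⟨x, rfl⟩, ?_⟩
    ext x
    exact congrArg Subtype.val (e.apply_symm_apply ⟨f x, hr ⟨x, rfl⟩⟩)
  let ψ : Module.Dual k (Module.Dual k V₀) :=
    { toFun β := θ (contractLeft L.V β ∘ₗ f₀)
      map_add' β β' := by
        simp [contractLeft, LinearMap.rTensor_add, LinearMap.add_comp, LinearMap.comp_add]
      map_smul' c β := by
        simp [contractLeft, LinearMap.rTensor_smul, LinearMap.smul_comp, LinearMap.comp_smul] }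
  refine ⟨(Module.evalEquiv k V₀).symm ψ, fun α ↦ ?_⟩
  have h : (α ∘ₗ V₀.subtype) ((Module.evalEquiv k V₀).symm ψ) = ψ (α ∘ₗ V₀.subtype) := by simp
  refine h.trans ?_
  change θ _ = _
  congr 1
  rw [← hf₀, contractLeft, contractLeft, LinearMap.rTensor_comp]
  rfl

/-- If the identity of `K ⊠ L` is a sum of maps factoring through `K ⊠ j` and `i ⊠ L`, with `L`
finitely generated, then `i` or `j` is a split monomorphism. -/
theorem exists_retraction_or_exists_retraction {K P : Rep.{0} k G} {L Q : Rep.{0} k H}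
    (hL : L.IsFG) (i : K ⟶ P) (j : L ⟶ Q) (u : extTensor K Q ⟶ extTensor K L)
    (v : extTensor P L ⟶ extTensor K L)
    (huv : ∀ (x : K.V) (y : L.V),
      x ⊗ₜ[k] y = u.hom (x ⊗ₜ[k] j.hom y) + v.hom (i.hom x ⊗ₜ[k] y)) :
    (∃ r, i ≫ r = 𝟙 K) ∨ ∃ r, j ≫ r = 𝟙 L := by
  refine or_iff_not_imp_right.2 fun hj ↦ ?_
  let J : Submodule k (L.V →ₗ[k] L.V) :=
    { carrier := {f | ∃ r : Q ⟶ L, (j ≫ r).hom.toLinearMap = f}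
      zero_mem' := ⟨0, by rw [Limits.comp_zero]; rfl⟩
      add_mem' := by
        rintro _ _ ⟨r, rfl⟩ ⟨r', rfl⟩
        exact ⟨r + r', by rw [Preadditive.comp_add]; rfl⟩
      smul_mem' := by
        rintro c _ ⟨r, rfl⟩
        exact ⟨c • r, by rw [Linear.comp_smul]; rfl⟩ }
  have hJ : LinearMap.id ∉ J := fun ⟨r, hr⟩ ↦
    hj ⟨r, Rep.hom_ext (Representation.IntertwiningMap.ext hr)⟩
  obtain ⟨θ, hθ, hθJ⟩ : ∃ θ : Module.Dual k (L.V →ₗ[k] L.V), θ LinearMap.id = 1 ∧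
      ∀ f ∈ J, θ f = 0 := by
    obtain ⟨θ, hθ, hθJ⟩ := Submodule.exists_le_ker_of_notMem hJ
    refine ⟨(θ LinearMap.id)⁻¹ • θ, by simp [hθ], fun f hf ↦ ?_⟩
    rw [LinearMap.smul_apply, LinearMap.mem_ker.1 (hθJ hf), smul_zero]
  have hρ₁ (g : G) (t : K.V ⊗[k] L.V) :
      (extTensor K L).ρ (g, 1) t = (K.ρ g).rTensor L.V t := by
    change TensorProduct.map (K.ρ g) (L.ρ 1) t = _
    rw [map_one]
    rfl
  have hρ₂ (h : H) (t : K.V ⊗[k] L.V) :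
      (extTensor K L).ρ (1, h) t = (L.ρ h).lTensor K.V t := by
    change TensorProduct.map (K.ρ 1) (L.ρ h) t = _
    rw [map_one]
    rfl
  have key (p : P.V) := hL.exists_dual_eq (V := K.V)
    (v.hom.toLinearMap ∘ₗ TensorProduct.mk k P.V L.V p) (fun g x ↦ by
      have h := Rep.hom_comm_apply v (1, g) (p ⊗ₜ x)
      rw [extTensor_ρ_tmul, map_one, hρ₂] at h
      exact h) θ
  choose r hr using key
  have hext {x x' : K.V} (h : ∀ α : Module.Dual k K.V, α x = α x') : x = x' := by
    rw [← sub_eq_zero, ← Module.forall_dual_apply_eq_zero_iff k]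
    exact fun α ↦ by rw [map_sub, h, sub_self]
  refine ⟨Rep.ofHom ⟨
    { toFun := r
      map_add' p p' := hext fun α ↦ by
        rw [map_add, hr, hr, hr, map_add, LinearMap.comp_add, LinearMap.comp_add, map_add]
      map_smul' c p := hext fun α ↦ by
        rw [map_smul, hr, hr, map_smul, LinearMap.comp_smul, LinearMap.comp_smul, map_smul]
        rfl },
    fun g ↦ LinearMap.ext fun p ↦ hext fun α ↦ ?_⟩, ?_⟩
  · change α (r (P.ρ g p)) = (α ∘ₗ K.ρ g) (r p)
    rw [hr, hr]
    congr 1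
    ext y
    have h := Rep.hom_comm_apply v (g, 1) (p ⊗ₜ y)
    rw [extTensor_ρ_tmul, map_one, hρ₁] at h
    change contractLeft L.V α (v.hom (P.ρ g p ⊗ₜ[k] y)) = contractLeft L.V _ (v.hom (p ⊗ₜ[k] y))
    refine (congrArg (contractLeft L.V α) h).trans ?_
    rw [contractLeft, contractLeft, LinearMap.rTensor_comp]
    rfl
  · ext x
    refine hext fun α ↦ ?_
    change α (r (i.hom x)) = α x
    let s : Q ⟶ L := Rep.ofHom ⟨contractLeft L.V α ∘ₗ u.hom.toLinearMap ∘ₗ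
      TensorProduct.mk k K.V Q.V x, fun h ↦ LinearMap.ext fun q ↦ by
        have h' := Rep.hom_comm_apply u (1, h) (x ⊗ₜ q)
        rw [extTensor_ρ_tmul, map_one, hρ₂] at h'
        refine (congrArg (contractLeft L.V α) h').trans ?_
        change (contractLeft L.V α ∘ₗ (L.ρ h).lTensor K.V) _ =
          (L.ρ h ∘ₗ contractLeft L.V α) _
        congr 1
        ext a b
        simp [contractLeft_tmul]⟩
    have hs : contractLeft L.V α ∘ₗ v.hom.toLinearMap ∘ₗ TensorProduct.mk k P.V L.V (i.hom x) =
        α x • LinearMap.id - (j ≫ s).hom.toLinearMap := by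
      ext y
      refine eq_sub_iff_add_eq'.2 ?_
      have h := congrArg (contractLeft L.V α) (huv x y)
      rw [map_add, contractLeft_tmul] at h
      exact h.symm
    rw [hr, hs, map_sub, hθJ _ ⟨s, rfl⟩, map_smul, hθ]
    simp

/-- Representations with a resolution of length less than `n` by projectives, all of whose syzygies
are finitely generated. -/
def HasFGProjectiveResolution : ℕ → Rep.{0} k G → Prop
  | 0, Y => Limits.IsZero Y
  | n + 1, Y => Y.IsFG ∧ ∃ S : ShortComplex (Rep.{0} k G), S.ShortExact ∧ Projective S.X₂ ∧
      S.X₃ = Y ∧ HasFGProjectiveResolution n S.X₁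

theorem HasFGProjectiveResolution.hasProjectiveDimensionLT {n : ℕ} {Y : Rep.{0} k G}
    (h : HasFGProjectiveResolution n Y) : HasProjectiveDimensionLT Y n := by
  induction n generalizing Y with
  | zero => exact Limits.IsZero.hasProjectiveDimensionLT_zero h
  | succ n ih =>
    obtain ⟨-, S, hS, hP, rfl, h⟩ := h
    exact hS.hasProjectiveDimensionLT_X₃ n (ih h)
      (hasProjectiveDimensionLT_of_ge _ 1 (n + 1) (by lia))

theorem HasFGProjectiveResolution.isFG {n : ℕ} {Y : Rep.{0} k G}
    (h : HasFGProjectiveResolution n Y) : Y.IsFG := by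
  cases n with
  | zero =>
    have : Subsingleton Y.V := (Rep.isZero_iff k G Y).1 h
    exact ⟨∅, fun W _ _ ↦ Subsingleton.elim _ _⟩
  | succ n => exact h.1

theorem projective_of_retraction {S : ShortComplex (Rep.{0} k G)} (hS : S.ShortExact)
    [Projective S.X₂] {r : S.X₂ ⟶ S.X₁} (hr : S.f ≫ r = 𝟙 S.X₁) : Projective S.X₃ := by
  have := (ShortComplex.Splitting.ofExactOfRetraction S hS.exact r hr hS.epi_g)
  exact Retract.projective ⟨this.s, S.g, this.s_g⟩

theorem not_hasProjectiveDimensionLT_extTensor_two {X : Rep.{0} k G} {Y : Rep.{0} k H} {N : ℕ}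
    (hX : HasProjectiveDimensionLT X 2) (hX' : ¬ HasProjectiveDimensionLT X 1)
    (hY : HasProjectiveDimensionLT Y 2) (hY' : ¬ HasProjectiveDimensionLT Y 1)
    (hN : HasFGProjectiveResolution N Y) :
    ¬ HasProjectiveDimensionLT (extTensor X Y) 2 := by
  intro h
  obtain _ | N := N
  · exact hY' (have := hN.hasProjectiveDimensionLT
      hasProjectiveDimensionLT_of_ge Y 0 1 (by lia))
  obtain ⟨-, T, hT, hQ, rfl, hL⟩ := hN
  obtain ⟨S, hS, hP, rfl⟩ := exists_shortExact_projective X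
  have hK : Projective S.X₁ := projective_iff_hasProjectiveDimensionLT_one.2
    ((hS.hasProjectiveDimensionLT_X₃_iff 0 hP).1 hX)
  let φ : T.map (extTensorLeft S.X₁) ⟶ T.map (extTensorLeft S.X₂) :=
    { τ₁ := (extTensorRight T.X₁).map S.f
      τ₂ := (extTensorRight T.X₂).map S.f
      τ₃ := (extTensorRight T.X₃).map S.f
      comm₁₂ := extTensor_hom_ext fun x y ↦ rfl
      comm₂₃ := extTensor_hom_ext fun x y ↦ rfl }
  have : Projective (T.map (extTensorLeft S.X₂)).X₂ := projective_extTensor S.X₂ T.X₂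
  have h₁ := extTensorRight_shortExact T.X₃ hS
  have : HasProjectiveDimensionLT ((extTensorRight T.X₃).obj S.X₃) 2 := h
  obtain ⟨u, v, huv⟩ := (extTensorLeft_shortExact S.X₁ hT).exists_id_eq_comp_add_comp
    (extTensorLeft_shortExact S.X₂ hT) φ h₁
  rcases exists_retraction_or_exists_retraction hL.isFG S.f T.f u v (fun x y ↦
    congrArg (fun f : extTensor S.X₁ T.X₁ ⟶ extTensor S.X₁ T.X₁ ↦ f.hom (x ⊗ₜ[k] y)) huv)
    with ⟨r, hr⟩ | ⟨r, hr⟩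
  · exact hX' (projective_iff_hasProjectiveDimensionLT_one.1 (projective_of_retraction hS hr))
  · exact hY' (projective_iff_hasProjectiveDimensionLT_one.1 (projective_of_retraction hT hr))

theorem not_hasProjectiveDimensionLT_extTensor {X : Rep.{0} k G} {Y : Rep.{0} k H} {N n m : ℕ}
    (hX : HasProjectiveDimensionLT X (n + 2)) (hX' : ¬ HasProjectiveDimensionLT X (n + 1))
    (hY : HasProjectiveDimensionLT Y (m + 2)) (hY' : ¬ HasProjectiveDimensionLT Y (m + 1))
    (hN : HasFGProjectiveResolution N Y) :
    ¬ HasProjectiveDimensionLT (extTensor X Y) (n + m + 2) := by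
  induction n generalizing X with
  | succ n ih =>
    intro h
    obtain ⟨S, hS, hP, rfl⟩ := exists_shortExact_projective X
    refine ih ((hS.hasProjectiveDimensionLT_X₃_iff _ hP).1 hX)
      (fun h' ↦ hX' ((hS.hasProjectiveDimensionLT_X₃_iff _ hP).2 h')) ?_
    have h₂ := hasProjectiveDimensionLT_extTensor_of_projective S.X₂ (m + 2) Y
    refine (extTensorRight_shortExact Y hS).hasProjectiveDimensionLT_X₁ _
      (hasProjectiveDimensionLT_of_ge (extTensor S.X₂ Y) (m + 2) _ (by lia)) ?_
    rwa [show n + m + 2 + 1 = n + 1 + m + 2 by lia]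
  | zero =>
    induction m generalizing Y N with
    | zero => exact not_hasProjectiveDimensionLT_extTensor_two hX hX' hY hY' hN
    | succ m ih =>
      intro h
      obtain _ | N := N
      · exact hY' (have := hN.hasProjectiveDimensionLT
          hasProjectiveDimensionLT_of_ge Y 0 _ (by lia))
      obtain ⟨-, T, hT, hQ, rfl, hL⟩ := hN
      refine ih ((hT.hasProjectiveDimensionLT_X₃_iff _ hQ).1 hY)
        (fun h' ↦ hY' ((hT.hasProjectiveDimensionLT_X₃_iff _ hQ).2 h')) hL ?_
      have h₂ := hasProjectiveDimensionLT_extTensor 2 0 X T.X₂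
      refine (extTensorLeft_shortExact X hT).hasProjectiveDimensionLT_X₁ _
        (hasProjectiveDimensionLT_of_ge (extTensor X T.X₂) 2 _ (by lia)) ?_
      rwa [show 0 + m + 2 + 1 = 0 + (m + 1) + 2 by lia]

end Rep

namespace Rep

section GroupRing

variable (k : Type) [Field k] (Γ : Type) [Group Γ]

/-- The representation of `Γ` over `k` obtained from a `ℤΓ`-module by extension of scalars. -/
noncomputable def ofGroupRing (M : Type) [AddCommGroup M] [Module (MonoidAlgebra ℤ Γ) M] :
    Rep.{0} k Γ :=
  Rep.of (X := k ⊗[ℤ] M)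
    { toFun g := ((Algebra.lsmul ℤ ℤ M (MonoidAlgebra.of ℤ Γ g)).baseChange k :
        k ⊗[ℤ] M →ₗ[k] k ⊗[ℤ] M)
      map_one' := by rw [map_one, map_one]; ext; simp
      map_mul' g h := by rw [map_mul, map_mul]; ext; simp }

variable {Γ} {M M' M'' : Type} [AddCommGroup M] [Module (MonoidAlgebra ℤ Γ) M]
  [AddCommGroup M'] [Module (MonoidAlgebra ℤ Γ) M']
  [AddCommGroup M''] [Module (MonoidAlgebra ℤ Γ) M'']

/-- Functoriality of `Rep.ofGroupRing`. -/
noncomputable def ofGroupRingMap (f : M →ₗ[MonoidAlgebra ℤ Γ] M') :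
    ofGroupRing k Γ M ⟶ ofGroupRing k Γ M' :=
  Rep.ofHom ⟨(f.restrictScalars ℤ).baseChange k, fun g ↦ by
    ext x
    simp⟩

variable (Γ M)

theorem ofGroupRing_isFG [Module.Finite (MonoidAlgebra ℤ Γ) M] : (ofGroupRing k Γ M).IsFG := by
  classical
  obtain ⟨s, hs⟩ := Module.Finite.fg_top (R := MonoidAlgebra ℤ Γ) (M := M)
  let ι : M →+ (ofGroupRing k Γ M).V := (TensorProduct.mk ℤ k M 1).toAddMonoidHom
  refine ⟨s.image ι, fun W hW hsW ↦ ?_⟩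
  let W' : Submodule (MonoidAlgebra ℤ Γ) M :=
    { carrier := {x | ι x ∈ W}
      zero_mem' := by
        change ι 0 ∈ W
        exact (map_zero ι).symm ▸ W.zero_mem
      add_mem' := fun {x y} hx hy ↦ by
        change ι (x + y) ∈ W
        exact (map_add ι x y).symm ▸ W.add_mem hx hy
      smul_mem' := fun a x hx ↦ by
        change ι (a • x) ∈ W
        induction a using MonoidAlgebra.induction_on with
        | of g => exact hW g _ hx
        | add a b ha hb =>
          rw [add_smul, map_add]
          exact W.add_mem ha hb
        | smul n a ha =>
          rw [smul_assoc, map_zsmul]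
          exact W.toAddSubgroup.zsmul_mem ha n }
  have hW' : W' = ⊤ := by
    rw [← top_le_iff, ← hs, Submodule.span_le]
    exact fun x hx ↦ hsW (Finset.mem_coe.2 (Finset.mem_image_of_mem ι hx))
  refine (Submodule.eq_top_iff' (p := W)).2 fun t ↦ ?_
  induction t using TensorProduct.induction_on with
  | zero => exact W.zero_mem
  | add a b ha hb => exact W.add_mem ha hb
  | tmul c x =>
    have hx : x ∈ W' := hW' ▸ Submodule.mem_top
    have h := W.smul_mem c hx
    have hc : c • ι x = c ⊗ₜ[ℤ] x := by
      change c • ((1 : k) ⊗ₜ[ℤ] x) = _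
      rw [smul_tmul', smul_eq_mul, mul_one]
    exact hc ▸ h

theorem projective_ofGroupRing [Module.Free (MonoidAlgebra ℤ Γ) M] :
    Projective (ofGroupRing k Γ M) where
  factors {E X} f e _ := by
    let mE : Module (MonoidAlgebra ℤ Γ) E.V :=
      Module.compHom E.V (MonoidAlgebra.lift ℤ (Module.End k E.V) Γ E.ρ).toRingHom
    let mX : Module (MonoidAlgebra ℤ Γ) X.V :=
      Module.compHom X.V (MonoidAlgebra.lift ℤ (Module.End k X.V) Γ X.ρ).toRingHom
    have hE (g : Γ) (x : E.V) : MonoidAlgebra.of ℤ Γ g • x = E.ρ g x :=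
      congrArg (fun φ : Module.End k E.V ↦ φ x) (MonoidAlgebra.lift_of E.ρ g)
    have hX (g : Γ) (x : X.V) : MonoidAlgebra.of ℤ Γ g • x = X.ρ g x :=
      congrArg (fun φ : Module.End k X.V ↦ φ x) (MonoidAlgebra.lift_of X.ρ g)
    let e' : E.V →ₗ[MonoidAlgebra ℤ Γ] X.V :=
      MonoidAlgebra.equivariantOfLinearOfComm (e.hom.toLinearMap.restrictScalars ℤ)
        fun g x ↦ (congrArg e.hom (hE g x)).trans
          ((Rep.hom_comm_apply e g x).trans (hX g (e.hom x)).symm)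
    let f' : M →ₗ[MonoidAlgebra ℤ Γ] X.V :=
      MonoidAlgebra.equivariantOfLinearOfComm
        (f.hom.toLinearMap.restrictScalars ℤ ∘ₗ TensorProduct.mk ℤ k M 1)
        fun g x ↦ (Rep.hom_comm_apply f g ((1 : k) ⊗ₜ[ℤ] x)).trans (hX g _).symm
    obtain ⟨φ, hφ⟩ := Module.projective_lifting_property e' f' ((epi_iff_surjective e).1 ‹_›)
    refine ⟨Rep.ofHom ⟨(φ.restrictScalars ℤ).liftBaseChange k, fun g ↦ ?_⟩, ?_⟩
    · ext x
      change (φ.restrictScalars ℤ).liftBaseChange k ((1 : k) ⊗ₜ[ℤ] (MonoidAlgebra.of ℤ Γ g • x)) =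
        E.ρ g ((φ.restrictScalars ℤ).liftBaseChange k ((1 : k) ⊗ₜ[ℤ] x))
      rw [LinearMap.liftBaseChange_tmul, LinearMap.liftBaseChange_tmul, one_smul, one_smul]
      exact (φ.map_smul (MonoidAlgebra.of ℤ Γ g) x).trans (hE g (φ x))
    · refine Rep.hom_ext (Representation.IntertwiningMap.ext
        (TensorProduct.AlgebraTensorModule.curry_injective (LinearMap.ext_ring
          (LinearMap.ext fun x ↦ ?_))))
      change e.hom ((φ.restrictScalars ℤ).liftBaseChange k ((1 : k) ⊗ₜ[ℤ] x)) = f' x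
      rw [LinearMap.liftBaseChange_tmul, one_smul, ← hφ]
      rfl

variable {Γ M}

theorem ofGroupRing_shortExact {i : M →ₗ[MonoidAlgebra ℤ Γ] M'} {p : M' →ₗ[MonoidAlgebra ℤ Γ] M''}
    (hi : Function.Injective i) (hip : Function.Exact i p) (hp : Function.Surjective p)
    [Module.Flat ℤ M''] :
    ∃ w, (ShortComplex.mk (ofGroupRingMap k i) (ofGroupRingMap k p) w).ShortExact := by
  have hex : Function.Exact (i.restrictScalars ℤ) (p.restrictScalars ℤ) := hip
  have hex' := lTensor_exact k hex hp
  refine ⟨?_, ?_⟩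
  · refine Rep.hom_ext (Representation.IntertwiningMap.ext (LinearMap.ext fun x ↦ ?_))
    exact hex'.apply_apply_eq_zero x
  · rw [shortExact_iff]
    exact ⟨LinearMap.lTensor_injective_of_exact_of_flat _ hp _ hi hex k, hex', LinearMap.lTensor_surjective k hp⟩

theorem hasFGProjectiveResolution_ofGroupRing (N : ℕ) (C : ℕ → Type)
    [∀ n, AddCommGroup (C n)] [∀ n, Module (MonoidAlgebra ℤ Γ) (C n)]
    [∀ n, Module.Free (MonoidAlgebra ℤ Γ) (C n)] [∀ n, Module.Finite (MonoidAlgebra ℤ Γ) (C n)]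
    (hC : ∀ n, N ≤ n → Subsingleton (C n)) (d : ∀ n, C (n + 1) →ₗ[MonoidAlgebra ℤ Γ] C n)
    (ε : C 0 →ₗ[MonoidAlgebra ℤ Γ] M) (hε : Function.Surjective ε)
    (h₀ : LinearMap.range (d 0) = LinearMap.ker ε)
    (hd : ∀ n, LinearMap.range (d (n + 1)) = LinearMap.ker (d n)) [Module.IsTorsionFree ℤ M] :
    HasFGProjectiveResolution N (ofGroupRing k Γ M) := by
  induction N generalizing C M with
  | zero =>
    have := hC 0 le_rfl
    have : Subsingleton M := hε.subsingleton
    exact (Rep.isZero_iff k Γ _).2 (inferInstanceAs (Subsingleton (k ⊗[ℤ] M)))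
  | succ N ih =>
    have : Module.Finite (MonoidAlgebra ℤ Γ) M := Module.Finite.of_surjective ε hε
    have : Module.Free ℤ (C 0) := Module.Free.trans (S := MonoidAlgebra ℤ Γ)
    have : Module.IsTorsionFree ℤ (LinearMap.ker ε) :=
      Function.Injective.moduleIsTorsionFree _ (LinearMap.ker ε).injective_subtype fun _ _ ↦ rfl
    obtain ⟨w, hS⟩ := ofGroupRing_shortExact k (i := (LinearMap.ker ε).subtype) (p := ε)
      (Submodule.injective_subtype _) (LinearMap.exact_subtype_ker_map ε) hε
    refine ⟨ofGroupRing_isFG k Γ M, _, hS, projective_ofGroupRing k Γ (C 0), rfl,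
      ih (fun n ↦ C (n + 1)) (fun n hn ↦ hC (n + 1) (by lia)) (fun n ↦ d (n + 1))
        ((d 0).codRestrict (LinearMap.ker ε) fun x ↦ h₀ ▸ ⟨x, rfl⟩) ?_ ?_ fun n ↦ hd (n + 1)⟩
    · rintro ⟨x, hx⟩
      obtain ⟨y, rfl⟩ := h₀.symm ▸ hx
      exact ⟨y, rfl⟩
    · rw [LinearMap.ker_codRestrict]
      exact hd 0

theorem trivialZ_smul (g : Γ) (x : TrivialZ Γ) : MonoidAlgebra.of ℤ Γ g • x = x := by
  change MonoidAlgebra.single g 1 • x = x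
  rw [Representation.single_smul]
  exact one_smul ℤ _

variable (Γ)

/-- Extending the scalars of the trivial `ℤΓ`-module to `k` gives the trivial representation. -/
noncomputable def ofGroupRingTrivialZIso : ofGroupRing k Γ (TrivialZ Γ) ≅ Rep.trivial k Γ k :=
  Rep.mkIso (Representation.Equiv.mk
    ((TensorProduct.AlgebraTensorModule.rid ℤ k k : k ⊗[ℤ] ℤ ≃ₗ[k] k)) fun g ↦ by
      refine TensorProduct.AlgebraTensorModule.curry_injective (LinearMap.ext_ring
        (LinearMap.ext fun x ↦ ?_))
      exact congrArg (fun y : ℤ ↦ y • (1 : k)) (trivialZ_smul g x))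

variable {Γ}

theorem _root_.IsGeomFinite.exists_hasFGProjectiveResolution (h : IsGeomFinite Γ) :
    ∃ N, HasFGProjectiveResolution N (ofGroupRing k Γ (TrivialZ Γ)) := by
  obtain ⟨N, C, _, _, _, _, hC, d, ε, hε, h₀, hd⟩ := h
  have : Module.IsTorsionFree ℤ (TrivialZ Γ) := inferInstanceAs (Module.IsTorsionFree ℤ ℤ)
  exact ⟨N + 1, hasFGProjectiveResolution_ofGroupRing k (N + 1) C (fun n hn ↦ hC n hn) d ε hε h₀ hd⟩

end GroupRing
end Rep

namespace Rep
variable {k : Type} [Field k] {G : Type} [Group G]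

theorem subsingleton_groupCohomology_succ_iff (M : Rep.{0} k G) (n : ℕ)
    (P : ProjectiveResolution (Rep.trivial k G k)) :
    Subsingleton (groupCohomology M (n + 1)) ↔
      ∀ f : P.complex.X (n + 1) ⟶ M, P.complex.d (n + 2) (n + 1) ≫ f = 0 →
        ∃ g : P.complex.X n ⟶ M, P.complex.d (n + 1) n ≫ g = f := by
  rw [← ModuleCat.isZero_iff_subsingleton, (groupCohomologyIso M (n + 1) P).isZero_iff,
    ← HomologicalComplex.exactAt_iff_isZero_homology,
    HomologicalComplex.exactAt_iff' _ n (n + 1) (n + 2) (by simp) (by simp),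
    ShortComplex.moduleCat_exact_iff]
  constructor
  · intro h f hf
    exact h f hf
  · intro h f hf
    exact h f hf

theorem forall_ext_trivial_succ_eq_zero_iff.{w} [HasExt.{w} (Rep.{0} k G)] (M : Rep.{0} k G) (n : ℕ) :
    (∀ e : Abelian.Ext (Rep.trivial k G k) M (n + 1), e = 0) ↔
      Subsingleton (groupCohomology M (n + 1)) := by
  let P := barResolution k G
  rw [subsingleton_groupCohomology_succ_iff M n P]
  constructor
  · intro h f hf
    exact (P.extMk_eq_zero_iff f (n + 2) rfl hf n rfl).1 (h _)
  · intro h e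
    obtain ⟨f, hf, rfl⟩ := P.extMk_surjective e (n + 2) rfl
    exact (P.extMk_eq_zero_iff f (n + 2) rfl hf n rfl).2 (h f hf)

theorem cohDim_eq_of_hasProjectiveDimensionLT {n : ℕ}
    (h : HasProjectiveDimensionLT (Rep.trivial k G k) (n + 1))
    (h' : ¬ HasProjectiveDimensionLT (Rep.trivial k G k) n) : cohDim k G = n := by
  let := HasExt.standard (Rep.{0} k G)
  refine le_antisymm (sSup_le ?_) ?_
  · rintro _ ⟨i, M, rfl, hM⟩
    by_contra! hi
    obtain ⟨j, rfl⟩ : ∃ j, i = j + 1 := ⟨i - 1, by have := Nat.cast_lt.1 hi; lia⟩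
    refine not_subsingleton (groupCohomology M (j + 1))
      ((forall_ext_trivial_succ_eq_zero_iff M j).1 fun e ↦ ?_)
    exact e.eq_zero_of_hasProjectiveDimensionLT (n + 1) (Nat.cast_lt.1 hi)
  · obtain _ | n := n
    · simp
    · by_contra! hn
      refine h' ((hasProjectiveDimensionLT_iff _ _).2 fun i hi M e ↦ ?_)
      obtain rfl | hi := hi.eq_or_lt
      · refine (forall_ext_trivial_succ_eq_zero_iff M n).2 ?_ e
        by_contra hM
        rw [not_subsingleton_iff_nontrivial] at hM
        exact hn.not_ge (le_sSup ⟨_, M, rfl, hM⟩)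
      · exact e.eq_zero_of_hasProjectiveDimensionLT (n + 2) hi

/-- The external tensor product of trivial representations is trivial. -/
noncomputable def extTensorTrivialIso {H : Type} [Group H] :
    extTensor (Rep.trivial k G k) (Rep.trivial k H k) ≅ Rep.trivial k (G × H) k :=
  Rep.mkIso (Representation.Equiv.mk (TensorProduct.lid k k) fun _ ↦
    TensorProduct.ext' fun _ _ ↦ rfl)

theorem cohDim_prod_self {N : ℕ} {T : Rep.{0} k G} (e : T ≅ Rep.trivial k G k)
    (hT : HasFGProjectiveResolution N T) : cohDim k (G × G) = 2 * cohDim k G := by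
  have e' : extTensor T T ≅ Rep.trivial k (G × G) k :=
    (extTensorLeft T).mapIso e ≪≫ (extTensorRight (Rep.trivial k G k)).mapIso e ≪≫
      extTensorTrivialIso
  have hiff (n : ℕ) : HasProjectiveDimensionLT T n ↔
      HasProjectiveDimensionLT (Rep.trivial k G k) n :=
    ⟨fun _ ↦ hasProjectiveDimensionLT_of_iso e n, fun _ ↦ hasProjectiveDimensionLT_of_iso e.symm n⟩
  have hiff' (n : ℕ) : HasProjectiveDimensionLT (extTensor T T) n ↔
      HasProjectiveDimensionLT (Rep.trivial k (G × G) k) n :=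
    ⟨fun _ ↦ hasProjectiveDimensionLT_of_iso e' n,
      fun _ ↦ hasProjectiveDimensionLT_of_iso e'.symm n⟩
  have h₀ (H : Type) [Group H] : ¬ HasProjectiveDimensionLT (Rep.trivial k H k) 0 := fun _ ↦
    not_subsingleton k ((Rep.isZero_iff k H (Rep.trivial k H k)).1
      (isZero_of_hasProjectiveDimensionLT_zero _))
  classical
  have hex : ∃ n, HasProjectiveDimensionLT T n := ⟨N, hT.hasProjectiveDimensionLT⟩
  have hn := Nat.find_spec hex
  have hmin (m : ℕ) (hm : m < Nat.find hex) : ¬ HasProjectiveDimensionLT T m := Nat.find_min hex hm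
  generalize Nat.find hex = n at hn hmin
  match n with
  | 0 => exact absurd ((hiff 0).1 hn) (h₀ G)
  | 1 =>
    have h : HasProjectiveDimensionLT (extTensor T T) (1 + 0) := hasProjectiveDimensionLT_extTensor ..
    rw [cohDim_eq_of_hasProjectiveDimensionLT ((hiff' 1).1 h) (h₀ _),
      cohDim_eq_of_hasProjectiveDimensionLT ((hiff 1).1 hn) (h₀ _)]
    simp
  | n + 2 =>
    have h : HasProjectiveDimensionLT (extTensor T T) (n + 2 + (n + 1)) :=
      hasProjectiveDimensionLT_extTensor ..
    have hlt := hmin (n + 1) (by lia)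
    have h' := not_hasProjectiveDimensionLT_extTensor hn hlt hn hlt hT
    rw [show n + 2 + (n + 1) = n + n + 2 + 1 by lia, hiff'] at h
    rw [hiff'] at h'
    rw [hiff] at hn hlt
    rw [cohDim_eq_of_hasProjectiveDimensionLT h h',
      cohDim_eq_of_hasProjectiveDimensionLT hn hlt]
    push_cast
    ring
end Rep

end

/-- For any geometrically finite group `Γ` and any field `k`,
`cd_k(Γ × Γ) = 2 · cd_k(Γ)`. -/
theorem stmt13 (Γ : Type) [Group Γ] (hgf : IsGeomFinite Γ)
    (k : Type) [Field k] :
    cohDim k (Γ × Γ) = 2 * cohDim k Γ := by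
  obtain ⟨N, hN⟩ := hgf.exists_hasFGProjectiveResolution k
  exact Rep.cohDim_prod_self (Rep.ofGroupRingTrivialZIso k Γ) hN
end

section
/- For any geometrically finite group Γ there exists a field k (either ℚ or ℤ/p for some prime p) such that cd_k(Γ) = cd(Γ). -/
open Finset

universe u

/-- The complex `C` has the property that every `(n + 1)`-cocycle with values in `X` is a
coboundary. -/
def CohVanishes {R : Type} [Ring R] {C : ℕ → Type} [∀ n, AddCommGroup (C n)]
    [∀ n, Module R (C n)] (d : ∀ n, C (n + 1) →ₗ[R] C n) (n : ℕ)
    (X : Type) [AddCommGroup X] [Module R X] : Prop :=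
  ∀ f : C (n + 1) →ₗ[R] X, f ∘ₗ d (n + 1) = 0 → ∃ g : C n →ₗ[R] X, g ∘ₗ d n = f

section Torsion

variable {R : Type} [Ring R]

/-- A linear map from a finitely generated module to a torsion group has finite order. -/
theorem LinearMap.exists_nsmul_eq_zero_of_finite {C Y : Type} [AddCommGroup C] [Module R C]
    [Module.Finite R C] [AddCommGroup Y] [Module R Y] (φ : C →ₗ[R] Y)
    (hφ : ∀ c, ∃ m : ℕ, 0 < m ∧ m • φ c = 0) : ∃ m : ℕ, 0 < m ∧ m • φ = 0 := by
  obtain ⟨s, hs⟩ := Module.Finite.fg_top (R := R) (M := C)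
  choose m hm hmφ using hφ
  refine ⟨∏ c ∈ s, m c, Finset.prod_pos fun c _ => hm c, ?_⟩
  refine LinearMap.ext_on hs fun c hc => ?_
  obtain ⟨k, hk⟩ := Finset.dvd_prod_of_mem m (Finset.mem_coe.1 hc)
  rw [LinearMap.smul_apply, hk, mul_comm, mul_smul, hmφ, smul_zero, LinearMap.zero_apply]

/-- A linear map from a projective module lifts through any linear map containing its range. -/
theorem Module.exists_comp_eq_of_range_le {P X Y : Type} [AddCommGroup P] [Module R P]
    [Module.Projective R P] [AddCommGroup X] [Module R X] [AddCommGroup Y] [Module R Y]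
    (ι : X →ₗ[R] Y) (φ : P →ₗ[R] Y) (h : ∀ c, φ c ∈ LinearMap.range ι) :
    ∃ ψ : P →ₗ[R] X, ι ∘ₗ ψ = φ := by
  obtain ⟨ψ, hψ⟩ := Module.projective_lifting_property ι.rangeRestrict
    (φ.codRestrict (LinearMap.range ι) h) ι.surjective_rangeRestrict
  refine ⟨ψ, LinearMap.ext fun c => ?_⟩
  exact congrArg Subtype.val (LinearMap.congr_fun hψ c)

/-- The rationalization of a module over a ring. -/
noncomputable def rationalization (X : Type) [AddCommGroup X] [Module R X] :
    X →ₗ[R] TensorProduct ℤ X ℚ where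
  toFun x := x ⊗ₜ[ℤ] (1 : ℚ)
  map_add' x y := TensorProduct.add_tmul x y 1
  map_smul' r x := (TensorProduct.smul_tmul' r x 1).symm

theorem nonempty_module_rat_tensorProduct (X : Type) [AddCommGroup X] :
    Nonempty (Module ℚ (TensorProduct ℤ X ℚ)) :=
  ⟨(TensorProduct.comm ℤ X ℚ).toAddEquiv.module ℚ⟩

theorem rationalization_exists_nsmul_mem (X : Type) [AddCommGroup X] [Module R X]
    (y : TensorProduct ℤ X ℚ) :
    ∃ m : ℕ, 0 < m ∧ m • y ∈ LinearMap.range (rationalization (R := R) X) := by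
  induction y with
  | zero => exact ⟨1, one_pos, by simp⟩
  | tmul x q =>
    refine ⟨q.den, q.den_pos, q.num • x, ?_⟩
    change (q.num • x) ⊗ₜ[ℤ] (1 : ℚ) = _
    rw [TensorProduct.smul_tmul, ← TensorProduct.tmul_smul]
    congr 1
    simp [Rat.den_mul_eq_num]
  | add a b ha hb =>
    obtain ⟨m, hm, hma⟩ := ha
    obtain ⟨k, hk, hkb⟩ := hb
    refine ⟨m * k, Nat.mul_pos hm hk, ?_⟩
    rw [smul_add]
    refine Submodule.add_mem _ ?_ ?_
    · rw [mul_comm, mul_smul]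
      exact Submodule.smul_of_tower_mem _ _ hma
    · rw [mul_smul]
      exact Submodule.smul_of_tower_mem _ _ hkb

theorem rationalization_exists_nsmul_eq_zero (X : Type) [AddCommGroup X] [Module R X]
    (x : X) (hx : rationalization (R := R) X x = 0) : ∃ m : ℕ, 0 < m ∧ m • x = 0 := by
  have hloc : IsLocalizedModule (nonZeroDivisors ℤ) (TensorProduct.mk ℤ ℚ X 1) :=
    (isLocalizedModule_iff_isBaseChange (nonZeroDivisors ℤ) ℚ _).2
      (TensorProduct.isBaseChange ℤ X ℚ)
  have h0 : TensorProduct.mk ℤ ℚ X 1 x = 0 := by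
    have := congrArg (TensorProduct.comm ℤ X ℚ) hx
    simpa [rationalization] using this
  obtain ⟨c, hc⟩ := (IsLocalizedModule.eq_zero_iff (nonZeroDivisors ℤ) _).1 h0
  refine ⟨(c : ℤ).natAbs, Int.natAbs_pos.2 (nonZeroDivisors.coe_ne_zero c), ?_⟩
  have hc' : (c : ℤ) • x = 0 := hc
  rw [← natCast_zsmul]
  rcases Int.natAbs_eq (c : ℤ) with h | h
  · rw [← h, hc']
  · rw [← neg_eq_zero, ← neg_smul, ← h, hc']

end Torsion

section TopDegree

variable {R : Type} [Ring R] {C : ℕ → Type} [∀ n, AddCommGroup (C n)] [∀ n, Module R (C n)]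
  (d : ∀ n, C (n + 1) →ₗ[R] C n)

/-- If cohomology with rational coefficients vanishes, integral cohomology is torsion. -/
theorem exists_nsmul_eq_comp_of_rat [∀ n, Module.Finite R (C n)]
    [∀ n, Module.Projective R (C n)] (n : ℕ)
    (hQ : ∀ (X : Type) [AddCommGroup X] [Module R X], Nonempty (Module ℚ X) →
      CohVanishes d n X)
    {X : Type} [AddCommGroup X] [Module R X] (f : C (n + 1) →ₗ[R] X)
    (hf : f ∘ₗ d (n + 1) = 0) :
    ∃ m : ℕ, 0 < m ∧ ∃ g : C n →ₗ[R] X, g ∘ₗ d n = m • f := by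
  set ι := rationalization (R := R) X
  obtain ⟨g, hg⟩ := hQ _ (nonempty_module_rat_tensorProduct X) (ι ∘ₗ f)
    (by rw [LinearMap.comp_assoc, hf, LinearMap.comp_zero])
  obtain ⟨m, hm, hmg⟩ := LinearMap.exists_nsmul_eq_zero_of_finite
    ((LinearMap.range ι).mkQ ∘ₗ g) fun c => by
      obtain ⟨m, hm, h⟩ := rationalization_exists_nsmul_mem (R := R) X (g c)
      refine ⟨m, hm, ?_⟩
      rw [LinearMap.comp_apply, ← map_nsmul, Submodule.mkQ_apply, Submodule.Quotient.mk_eq_zero]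
      exact h
  obtain ⟨g', hg'⟩ := Module.exists_comp_eq_of_range_le ι (m • g) fun c => by
    have := LinearMap.congr_fun hmg c
    rw [LinearMap.smul_apply, LinearMap.comp_apply, ← map_nsmul, Submodule.mkQ_apply,
      LinearMap.zero_apply, Submodule.Quotient.mk_eq_zero] at this
    exact this
  obtain ⟨k, hk, hkf⟩ := LinearMap.exists_nsmul_eq_zero_of_finite (m • f - g' ∘ₗ d n) fun c => by
    apply rationalization_exists_nsmul_eq_zero (R := R)
    have h1 := LinearMap.congr_fun hg c
    have h2 := LinearMap.congr_fun hg' (d n c)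
    simp only [LinearMap.comp_apply, LinearMap.smul_apply] at h1 h2
    rw [LinearMap.sub_apply, map_sub, LinearMap.smul_apply, map_nsmul, LinearMap.comp_apply]
    exact sub_eq_zero.2 (by rw [h2, h1])
  refine ⟨k * m, Nat.mul_pos hk hm, k • g', ?_⟩
  rw [LinearMap.smul_comp, mul_smul]
  rw [smul_sub, sub_eq_zero] at hkf
  exact hkf.symm

/-- If rational cohomology vanishes, integral cohomology has finite exponent. -/
theorem exists_uniform_nsmul_eq_comp_of_rat [∀ n, Module.Finite R (C n)]
    [∀ n, Module.Projective R (C n)] (n : ℕ)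
    (hQ : ∀ (X : Type) [AddCommGroup X] [Module R X], Nonempty (Module ℚ X) →
      CohVanishes d n X)
    (X : Type) [AddCommGroup X] [Module R X] :
    ∃ m : ℕ, 0 < m ∧ ∀ f : C (n + 1) →ₗ[R] X, f ∘ₗ d (n + 1) = 0 →
      ∃ g : C n →ₗ[R] X, g ∘ₗ d n = m • f := by
  by_contra! hcon
  choose! f hf hfg using hcon
  obtain ⟨m, hm, g, hg⟩ := exists_nsmul_eq_comp_of_rat d n hQ
    (LinearMap.pi fun i : ℕ => f (i + 1)) (by
      ext c i
      exact LinearMap.congr_fun (hf (i + 1) i.succ_pos) c)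
  obtain ⟨i, rfl⟩ := Nat.exists_eq_succ_of_ne_zero hm.ne'
  refine hfg (i + 1) i.succ_pos (LinearMap.proj i ∘ₗ g) (LinearMap.ext fun c => ?_)
  exact congrFun (LinearMap.congr_fun hg c) i

/-- In top degree, if cohomology with mod `p` coefficients vanishes, then integral cohomology is
`p`-divisible. -/
theorem exists_eq_nsmul_add_comp_of_mod (hd : ∀ n, d n ∘ₗ d (n + 1) = 0)
    [∀ n, Module.Projective R (C n)] (n p : ℕ)
    (htop : ∀ (X : Type) [AddCommGroup X] [Module R X], CohVanishes d (n + 1) X)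
    (hp : ∀ (X : Type) [AddCommGroup X] [Module R X], (∀ x : X, p • x = 0) →
      CohVanishes d n X)
    {X : Type} [AddCommGroup X] [Module R X] (f : C (n + 1) →ₗ[R] X)
    (hf : f ∘ₗ d (n + 1) = 0) :
    ∃ (h : C (n + 1) →ₗ[R] X) (g : C n →ₗ[R] X),
      h ∘ₗ d (n + 1) = 0 ∧ f = p • h + g ∘ₗ d n := by
  set μ : X →ₗ[R] X := p • LinearMap.id
  obtain ⟨g₀, hg₀⟩ := hp (X ⧸ LinearMap.range μ) (fun x => by
      obtain ⟨x, rfl⟩ := Submodule.mkQ_surjective _ x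
      rw [← map_nsmul, Submodule.mkQ_apply, Submodule.Quotient.mk_eq_zero]
      exact ⟨x, rfl⟩) ((LinearMap.range μ).mkQ ∘ₗ f)
    (by rw [LinearMap.comp_assoc, hf, LinearMap.comp_zero])
  obtain ⟨g, rfl⟩ := Module.projective_lifting_property (LinearMap.range μ).mkQ g₀
    (Submodule.mkQ_surjective _)
  obtain ⟨h, hh⟩ := Module.exists_comp_eq_of_range_le μ (f - g ∘ₗ d n) fun c => by
    have := LinearMap.congr_fun hg₀ c
    rw [← Submodule.Quotient.mk_eq_zero, ← Submodule.mkQ_apply, LinearMap.sub_apply, map_sub]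
    exact sub_eq_zero.2 this.symm
  have hker : ∀ c, (h ∘ₗ d (n + 1)) c ∈ LinearMap.ker μ := fun c => by
    have h1 := LinearMap.congr_fun hh (d (n + 1) c)
    have h2 := LinearMap.congr_fun hf c
    have h3 := LinearMap.congr_fun (hd n) c
    simp only [LinearMap.comp_apply, LinearMap.sub_apply, LinearMap.zero_apply] at h1 h2 h3
    rw [LinearMap.mem_ker, LinearMap.comp_apply, h1, h2, h3, map_zero, sub_zero]
  obtain ⟨u, hu⟩ := htop (LinearMap.ker μ) ((h ∘ₗ d (n + 1)).codRestrict _ hker) (by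
    ext c
    have h3 := LinearMap.congr_fun (hd (n + 1)) c
    simp only [LinearMap.comp_apply, LinearMap.zero_apply] at h3
    simp [h3])
  refine ⟨h - (LinearMap.ker μ).subtype ∘ₗ u, g, ?_, ?_⟩
  · ext c
    have := congrArg Subtype.val (LinearMap.congr_fun hu c)
    exact sub_eq_zero.2 this.symm
  · ext c
    have h1 := LinearMap.congr_fun hh c
    have h2 : p • (u c : X) = 0 := (u c).2
    have h3 : p • h c = f c - g (d n c) := h1
    simp [smul_sub, h2, h3]

/-- In top degree, cohomology vanishes as soon as it vanishes for all rational and all mod `p`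
coefficients. -/
theorem CohVanishes.of_rat_of_mod (hd : ∀ n, d n ∘ₗ d (n + 1) = 0)
    [∀ n, Module.Finite R (C n)] [∀ n, Module.Projective R (C n)] (n : ℕ)
    (htop : ∀ (X : Type) [AddCommGroup X] [Module R X], CohVanishes d (n + 1) X)
    (hQ : ∀ (X : Type) [AddCommGroup X] [Module R X], Nonempty (Module ℚ X) →
      CohVanishes d n X)
    (hp : ∀ p : ℕ, p.Prime → ∀ (X : Type) [AddCommGroup X] [Module R X],
      (∀ x : X, p • x = 0) → CohVanishes d n X)
    (X : Type) [AddCommGroup X] [Module R X] : CohVanishes d n X := by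
  have hdiv : ∀ m : ℕ, m ≠ 0 → ∀ f : C (n + 1) →ₗ[R] X, f ∘ₗ d (n + 1) = 0 →
      ∃ (h : C (n + 1) →ₗ[R] X) (g : C n →ₗ[R] X),
        h ∘ₗ d (n + 1) = 0 ∧ f = m • h + g ∘ₗ d n := by
    intro m
    induction m using Nat.recOnMul with
    | zero => exact fun h => absurd rfl h
    | one => exact fun _ f hf => ⟨f, 0, hf, by simp⟩
    | prime p hpp =>
      exact fun _ f hf => exists_eq_nsmul_add_comp_of_mod d hd n p htop (hp p hpp) f hf
    | mul a b iha ihb =>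
      intro hab f hf
      obtain ⟨h, g, hh, rfl⟩ := iha (left_ne_zero_of_mul hab) f hf
      obtain ⟨h', g', hh', rfl⟩ := ihb (right_ne_zero_of_mul hab) h hh
      refine ⟨h', a • g' + g, hh', ?_⟩
      rw [smul_add, mul_smul, LinearMap.add_comp, LinearMap.smul_comp, add_assoc]
  obtain ⟨m, hm, hmX⟩ := exists_uniform_nsmul_eq_comp_of_rat d n hQ X
  intro f hf
  obtain ⟨h, g, hh, rfl⟩ := hdiv m hm.ne' f hf
  obtain ⟨g', hg'⟩ := hmX h hh
  exact ⟨g' + g, by rw [LinearMap.add_comp, hg']⟩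

end TopDegree

section GroupCohomologyCriterion

open CategoryTheory

/-- Vanishing of a positive degree of a cochain complex of modules, at the level of cochains. -/
theorem CochainComplex.subsingleton_homology_succ_iff {k : Type} [Ring k]
    (K : CochainComplex (ModuleCat.{0} k) ℕ) (n : ℕ) :
    Subsingleton (K.homology (n + 1)) ↔
      ∀ f : K.X (n + 1), K.d (n + 1) (n + 2) f = 0 → ∃ g : K.X n, K.d n (n + 1) g = f := by
  rw [← ModuleCat.isZero_iff_subsingleton, ← HomologicalComplex.exactAt_iff_isZero_homology,
    HomologicalComplex.exactAt_iff' _ n (n + 1) (n + 2) (by simp) (by simp),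
    ShortComplex.moduleCat_exact_iff]
  rfl

theorem groupCohomology.subsingleton_succ_iff {k G : Type} [CommRing k] [Group G] (A : Rep k G)
    (n : ℕ) :
    Subsingleton (groupCohomology A (n + 1)) ↔
      ∀ f : (Fin (n + 1) → G) → A, inhomogeneousCochains.d A (n + 1) f = 0 →
        ∃ g : (Fin n → G) → A, inhomogeneousCochains.d A n g = f := by
  refine (CochainComplex.subsingleton_homology_succ_iff (inhomogeneousCochains A) n).trans ?_
  rw [inhomogeneousCochains.d_def, inhomogeneousCochains.d_def]

/-- Group cohomology does not depend on the ring of coefficients. -/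
theorem groupCohomology.subsingleton_succ_of_addEquiv {k k' G : Type} [CommRing k] [CommRing k']
    [Group G] (A : Rep k G) (B : Rep k' G) (e : A ≃+ B) (he : ∀ g a, e (A.ρ g a) = B.ρ g (e a))
    (n : ℕ) (h : Subsingleton (groupCohomology A (n + 1))) :
    Subsingleton (groupCohomology B (n + 1)) := by
  have hd : ∀ (m : ℕ) (f : (Fin m → G) → A),
      inhomogeneousCochains.d B m (e ∘ f) = e ∘ inhomogeneousCochains.d A m f := by
    intro m f
    funext g
    have hs : ∀ (j : ℕ) (a : A), e ((-1 : k) ^ j • a) = (-1 : k') ^ j • e a := by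
      intro j a
      rcases neg_one_pow_eq_or k j with h1 | h1 <;> rcases j.even_or_odd with hj | hj <;>
        simp [hj.neg_one_pow]
    simp [inhomogeneousCochains.d_hom_apply, he, hs]
  rw [groupCohomology.subsingleton_succ_iff] at h ⊢
  intro f hf
  obtain ⟨g, hg⟩ := h (e.symm ∘ f) (by
    have := hd _ (e.symm ∘ f)
    rw [← Function.comp_assoc, AddEquiv.self_comp_symm, Function.id_comp, hf] at this
    funext x
    exact e.injective ((congrFun this x).symm.trans (map_zero e).symm))
  refine ⟨e ∘ g, ?_⟩
  rw [hd, hg, ← Function.comp_assoc, AddEquiv.self_comp_symm, Function.id_comp]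

end GroupCohomologyCriterion

section Resolution

open CategoryTheory

/-- The chain complex of modules with prescribed differentials. -/
noncomputable def ModuleCat.chainComplex {R : Type} [Ring R] {C : ℕ → Type}
    [∀ n, AddCommGroup (C n)] [∀ n, Module R (C n)] (d : ∀ n, C (n + 1) →ₗ[R] C n)
    (hd : ∀ n, d n ∘ₗ d (n + 1) = 0) : ChainComplex (ModuleCat.{0} R) ℕ :=
  ChainComplex.of (fun n => ModuleCat.of R (C n)) (fun n => ModuleCat.ofHom (d n))
    fun n => by
      rw [← ModuleCat.ofHom_comp, hd]
      rfl

theorem ModuleCat.chainComplex_d {R : Type} [Ring R] {C : ℕ → Type}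
    [∀ n, AddCommGroup (C n)] [∀ n, Module R (C n)] (d : ∀ n, C (n + 1) →ₗ[R] C n)
    (hd : ∀ n, d n ∘ₗ d (n + 1) = 0) (n : ℕ) :
    (ModuleCat.chainComplex d hd).d (n + 1) n = ModuleCat.ofHom (d n) :=
  ChainComplex.of_d (fun n => ModuleCat.of R (C n)) (fun n => ModuleCat.ofHom (d n)) n

/-- A resolution of a module by projective modules, as a projective resolution in the category of
modules. -/
noncomputable def ModuleCat.projectiveResolutionOfExact {R : Type} [Ring R] {C : ℕ → Type}
    [∀ n, AddCommGroup (C n)] [∀ n, Module R (C n)] [∀ n, Module.Projective R (C n)]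
    (d : ∀ n, C (n + 1) →ₗ[R] C n) {Z : Type} [AddCommGroup Z] [Module R Z] (ε : C 0 →ₗ[R] Z)
    (hε : Function.Surjective ε) (h0 : LinearMap.range (d 0) = LinearMap.ker ε)
    (hd : ∀ n, LinearMap.range (d (n + 1)) = LinearMap.ker (d n)) :
    ProjectiveResolution (ModuleCat.of R Z) where
  complex := ModuleCat.chainComplex d fun n => LinearMap.range_le_ker_iff.1 (hd n).le
  projective n := (ModuleCat.of R (C n)).projective_of_categoryTheory_projective
  π := (ChainComplex.toSingle₀Equiv _ _).symm ⟨ModuleCat.ofHom ε, by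
    refine (congrArg (· ≫ ModuleCat.ofHom ε) (ModuleCat.chainComplex_d d _ 0)).trans ?_
    change ModuleCat.ofHom (d 0) ≫ ModuleCat.ofHom ε = 0
    rw [← ModuleCat.ofHom_comp, LinearMap.range_le_ker_iff.1 h0.le]
    rfl⟩
  quasiIso := ⟨fun m => by
    cases m with
    | zero =>
      rw [ChainComplex.quasiIsoAt₀_iff, ShortComplex.quasiIso_iff_of_zeros' _ rfl rfl rfl]
      constructor
      · rw [ShortComplex.moduleCat_exact_iff_range_eq_ker]
        simpa [ChainComplex.toSingle₀Equiv, ModuleCat.chainComplex_d] using! h0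
      · rw [ModuleCat.epi_iff_surjective]
        simpa [ChainComplex.toSingle₀Equiv] using! hε
    | succ m =>
      rw [quasiIsoAt_iff_exactAt' (hL := ChainComplex.exactAt_succ_single_obj ..),
        HomologicalComplex.exactAt_iff' _ (m + 2) (m + 1) m (by simp) (by simp),
        ShortComplex.moduleCat_exact_iff_range_eq_ker]
      simpa [ModuleCat.chainComplex_d] using! hd m⟩

/-- Transport of a projective resolution along an isomorphism. -/
noncomputable def CategoryTheory.ProjectiveResolution.transportIso {A : Type*} [Category A]
    [Abelian A] {X Y : A} (P : ProjectiveResolution X) (e : X ≅ Y) : ProjectiveResolution Y where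
  complex := P.complex
  π := P.π ≫ (ChainComplex.single₀ A).map e.hom

instance Rep.ofModuleMonoidAlgebra_additive (Γ : Type) [Group Γ] :
    (Rep.ofModuleMonoidAlgebra (k := ℤ) (G := Γ)).Additive where
  map_add := rfl

/-- The transported trivial module corresponds to the trivial representation. -/
noncomputable def Rep.ofModuleTrivialZIso (Γ : Type) [Group Γ] :
    Rep.ofModuleMonoidAlgebra.obj (ModuleCat.of (MonoidAlgebra ℤ Γ) (TrivialZ Γ)) ≅
      Rep.trivial ℤ Γ ℤ :=
  (Rep.unitIso (Rep.trivial ℤ Γ ℤ)).symm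

/-- Group cohomology of a module vanishes if and only if cocycles on a projective resolution are
coboundaries. -/
theorem groupCohomology.subsingleton_iff_cohVanishes {Γ : Type} [Group Γ] {C : ℕ → Type}
    [∀ n, AddCommGroup (C n)] [∀ n, Module (MonoidAlgebra ℤ Γ) (C n)]
    [∀ n, Module.Projective (MonoidAlgebra ℤ Γ) (C n)]
    (d : ∀ n, C (n + 1) →ₗ[MonoidAlgebra ℤ Γ] C n) (ε : C 0 →ₗ[MonoidAlgebra ℤ Γ] TrivialZ Γ)
    (hε : Function.Surjective ε) (h0 : LinearMap.range (d 0) = LinearMap.ker ε)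
    (hd : ∀ n, LinearMap.range (d (n + 1)) = LinearMap.ker (d n)) (n : ℕ)
    (X : Type) [AddCommGroup X] [Module (MonoidAlgebra ℤ Γ) X] :
    Subsingleton (groupCohomology
      (Rep.ofModuleMonoidAlgebra.obj (ModuleCat.of (MonoidAlgebra ℤ Γ) X)) (n + 1)) ↔
      CohVanishes d n X := by
  let P₀ := ModuleCat.projectiveResolutionOfExact d ε hε h0 hd
  let F : ModuleCat.{0} (MonoidAlgebra ℤ Γ) ⥤ Rep.{0} ℤ Γ := Rep.ofModuleMonoidAlgebra
  let P := (F.mapProjectiveResolution P₀).transportIso (Rep.ofModuleTrivialZIso Γ)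
  let M := F.obj (ModuleCat.of (MonoidAlgebra ℤ Γ) X)
  rw [(groupCohomologyIso M (n + 1) P).toLinearEquiv.toEquiv.subsingleton_congr,
    CochainComplex.subsingleton_homology_succ_iff]
  have hdd : ∀ m, d m ∘ₗ d (m + 1) = 0 := fun m => LinearMap.range_le_ker_iff.1 (hd m).le
  have hdP : ∀ m, P.complex.d (m + 1) m = F.map (ModuleCat.ofHom (d m)) := fun m =>
    congrArg F.map (ModuleCat.chainComplex_d d hdd m)
  constructor
  · intro h f hf
    obtain ⟨g, hg⟩ := h (F.map (ModuleCat.ofHom f)) (by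
      change P.complex.d (n + 2) (n + 1) ≫ F.map (ModuleCat.ofHom f) = 0
      rw [hdP]
      refine (F.map_comp _ _).symm.trans ?_
      rw [← ModuleCat.ofHom_comp, hf]
      exact F.map_zero _ _)
    obtain ⟨g', rfl⟩ := F.map_surjective g
    refine ⟨g'.hom, ?_⟩
    have hg' : P.complex.d (n + 1) n ≫ F.map g' = F.map (ModuleCat.ofHom f) := hg
    rw [hdP] at hg'
    have := F.map_injective ((F.map_comp _ _).trans hg')
    exact congrArg ModuleCat.Hom.hom this
  · intro h f hf
    obtain ⟨f', rfl⟩ := F.map_surjective (X := ModuleCat.of (MonoidAlgebra ℤ Γ) (C (n + 1))) f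
    have hf' : P.complex.d (n + 2) (n + 1) ≫ F.map f' = 0 := hf
    rw [hdP] at hf'
    have hf₀ := F.map_injective (((F.map_comp _ _).trans hf').trans (F.map_zero _ _).symm)
    obtain ⟨g, hg⟩ := h f'.hom (congrArg ModuleCat.Hom.hom hf₀)
    refine ⟨F.map (ModuleCat.ofHom g), ?_⟩
    change P.complex.d (n + 1) n ≫ F.map (ModuleCat.ofHom g) = F.map f'
    rw [hdP]
    refine (F.map_comp _ _).symm.trans (congrArg F.map ?_)
    rw [← ModuleCat.ofHom_comp, hg]
    rfl

end Resolution

section CohDim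

/-- A representation over any ring, viewed as an integral representation. -/
noncomputable def Rep.toInt {k G : Type} [CommRing k] [Group G] (V : Rep.{0} k G) :
    Rep.{0} ℤ G :=
  Rep.of
    { toFun := fun g => (V.ρ g).toAddMonoidHom.toIntLinearMap
      map_one' := by ext; simp
      map_mul' := fun g h => by ext; simp }

/-- A module over the integral group ring with a compatible `k`-module structure, viewed as a
representation over `k`. -/
noncomputable def Rep.ofModuleOfLinear (k : Type) {G : Type} [CommRing k] [Group G] (X : Type)
    [AddCommGroup X] [Module (MonoidAlgebra ℤ G) X] [Module k X]
    (hk : ∀ (φ : X →+ X) (c : k) (x : X), φ (c • x) = c • φ x) : Rep.{0} k G :=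
  Rep.of
    { toFun := fun g =>
        { toFun := fun x => MonoidAlgebra.of ℤ G g • x
          map_add' := smul_add _
          map_smul' := hk (DistribSMul.toAddMonoidHom X (MonoidAlgebra.of ℤ G g)) }
      map_one' := by ext x; simp [← MonoidAlgebra.one_def]
      map_mul' := fun g h => by
        ext x
        exact (congrArg (· • x) (map_mul (MonoidAlgebra.of ℤ G) g h)).trans (mul_smul _ _ _) }

theorem groupCohomology.subsingleton_ofModule_of_linear {k G : Type} [CommRing k] [Group G]
    (X : Type) [AddCommGroup X] [Module (MonoidAlgebra ℤ G) X] [Module k X]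
    (hk : ∀ (φ : X →+ X) (c : k) (x : X), φ (c • x) = c • φ x) (n : ℕ)
    (h : ∀ V : Rep.{0} k G, Subsingleton (groupCohomology V (n + 1))) :
    Subsingleton (groupCohomology
      (Rep.ofModuleMonoidAlgebra.obj (ModuleCat.of (MonoidAlgebra ℤ G) X)) (n + 1)) :=
  subsingleton_succ_of_addEquiv (Rep.ofModuleOfLinear k X hk)
    (Rep.ofModuleMonoidAlgebra.obj (ModuleCat.of (MonoidAlgebra ℤ G) X))
    (RestrictScalars.addEquiv ℤ (MonoidAlgebra ℤ G) X).symm (fun _ _ => rfl) n (h _)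

theorem groupCohomology.subsingleton_of_ofModule_toModule {G : Type} [Group G] (V : Rep.{0} ℤ G)
    (n : ℕ) (h : Subsingleton (groupCohomology
      (Rep.ofModuleMonoidAlgebra.obj (Rep.toModuleMonoidAlgebra.obj V)) (n + 1))) :
    Subsingleton (groupCohomology V (n + 1)) :=
  subsingleton_succ_of_addEquiv _ V (Rep.unitIsoAddEquiv (V := V)).symm (fun g a => by
    obtain ⟨v, rfl⟩ := (Rep.unitIsoAddEquiv (V := V)).surjective a
    rw [AddEquiv.symm_apply_apply, AddEquiv.symm_apply_eq]
    exact (Rep.unit_iso_comm V g v).symm) n h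

theorem le_cohDim {k G : Type} [CommRing k] [Group G] {n : ℕ} (V : Rep.{0} k G)
    (h : Nontrivial (groupCohomology V n)) : (n : ℕ∞) ≤ cohDim k G :=
  le_sSup ⟨n, V, rfl, h⟩

theorem cohDim_le {k G : Type} [CommRing k] [Group G] (n : ℕ)
    (h : ∀ m, n ≤ m → ∀ V : Rep.{0} k G, Subsingleton (groupCohomology V (m + 1))) :
    cohDim k G ≤ n := by
  refine sSup_le ?_
  rintro _ ⟨m, V, rfl, hV⟩
  by_contra hlt
  have hlt' : n < m := by exact_mod_cast not_le.1 hlt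
  obtain ⟨m, rfl⟩ := Nat.exists_eq_succ_of_ne_zero (Nat.ne_zero_of_lt hlt')
  exact not_subsingleton_iff_nontrivial.2 hV (h m (Nat.lt_succ_iff.1 hlt') V)

theorem cohDim_le_cohDim_int (k G : Type) [CommRing k] [Group G] : cohDim k G ≤ cohDim ℤ G := by
  refine sSup_le ?_
  rintro _ ⟨m, V, rfl, hV⟩
  cases m with
  | zero => simp
  | succ m =>
    refine le_cohDim V.toInt (not_subsingleton_iff_nontrivial.1 fun h => ?_)
    exact not_subsingleton_iff_nontrivial.2 hV
      (groupCohomology.subsingleton_succ_of_addEquiv V.toInt V (AddEquiv.refl V)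
        (fun _ _ => rfl) m h)

end CohDim

/-- For any geometrically finite group `Γ` there is a field `k`
(either `ℚ` or `ℤ/p` for some prime `p`) with `cd_k(Γ) = cd(Γ)`. -/
theorem stmt14 (Γ : Type) [Group Γ] (hgf : IsGeomFinite Γ) :
    cohDim ℚ Γ = cohDim ℤ Γ ∨
      ∃ p : ℕ, p.Prime ∧ cohDim (ZMod p) Γ = cohDim ℤ Γ := by
  obtain ⟨N, C, _, _, _, _, hN, d, ε, hε, h0, hd⟩ := hgf
  have hvan := groupCohomology.subsingleton_iff_cohVanishes d ε hε h0 hd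
  have hint : ∀ n, (∀ (X : Type) [AddCommGroup X] [Module (MonoidAlgebra ℤ Γ) X],
      CohVanishes d n X) → ∀ V : Rep.{0} ℤ Γ, Subsingleton (groupCohomology V (n + 1)) :=
    fun n h V => groupCohomology.subsingleton_of_ofModule_toModule V n
      ((hvan n (Rep.toModuleMonoidAlgebra.obj V)).2 (h _))
  have hbig : ∀ n, N ≤ n → ∀ V : Rep.{0} ℤ Γ, Subsingleton (groupCohomology V (n + 1)) := by
    refine fun n hn => hint n fun X _ _ f _ => ⟨0, LinearMap.ext fun c => ?_⟩
    have := hN (n + 1) (Nat.lt_succ_of_le hn)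
    rw [Subsingleton.elim c 0, map_zero, map_zero]
  classical
  have hex : ∃ n, ∀ m, n ≤ m → ∀ V : Rep.{0} ℤ Γ, Subsingleton (groupCohomology V (m + 1)) :=
    ⟨N, hbig⟩
  obtain ⟨n₀, hn₀, hmin⟩ : ∃ n,
      (∀ m, n ≤ m → ∀ V : Rep.{0} ℤ Γ, Subsingleton (groupCohomology V (m + 1))) ∧
      ∀ n' < n, ¬ ∀ m, n' ≤ m → ∀ V : Rep.{0} ℤ Γ, Subsingleton (groupCohomology V (m + 1)) :=
    ⟨Nat.find hex, Nat.find_spec hex, fun _ => Nat.find_min hex⟩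
  have hle : cohDim ℤ Γ ≤ n₀ := cohDim_le n₀ hn₀
  have heq : ∀ (k : Type) [CommRing k], (n₀ : ℕ∞) ≤ cohDim k Γ → cohDim k Γ = cohDim ℤ Γ :=
    fun k _ h => (cohDim_le_cohDim_int k Γ).antisymm (hle.trans h)
  cases n₀ with
  | zero => exact Or.inl (heq ℚ (by simp))
  | succ n =>
    by_contra! hcon
    have hk : ∀ (k : Type) [CommRing k], cohDim k Γ ≠ cohDim ℤ Γ →
        ∀ V : Rep.{0} k Γ, Subsingleton (groupCohomology V (n + 1)) := fun k _ hne V => by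
      by_contra hV
      exact hne (heq k (le_cohDim V (not_subsingleton_iff_nontrivial.1 hV)))
    have hdd : ∀ m, d m ∘ₗ d (m + 1) = 0 := fun m => LinearMap.range_le_ker_iff.1 (hd m).le
    refine hmin n n.lt_succ_self fun m hm => ?_
    obtain rfl | hm := hm.eq_or_lt
    · refine hint n (CohVanishes.of_rat_of_mod d hdd n (fun X _ _ => ?_) (fun X _ _ ⟨_⟩ => ?_)
        fun p hp X _ _ hX => ?_)
      · exact (hvan (n + 1) X).1 (hn₀ (n + 1) le_rfl _)
      · exact (hvan n X).1 (groupCohomology.subsingleton_ofModule_of_linear X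
          (fun φ c x => map_rat_smul φ c x) n (hk ℚ hcon.1))
      · let _ : Module (ZMod p) X := AddCommGroup.zmodModule hX
        exact (hvan n X).1 (groupCohomology.subsingleton_ofModule_of_linear X
          (fun φ c x => ZMod.map_smul φ c x) n (hk (ZMod p) (hcon.2 p hp)))
    · exact hn₀ m hm
end

section
/- For any geometrically finite group Γ, cd(Γ × Γ) = 2 · cd(Γ). -/
open Finset

universe u

section CohomologyAsExt

open CategoryTheory Abelian

variable {G : Type} [Group G]

theorem subsingleton_groupCohomology_succ_iff (A : Rep.{0} ℤ G) (n : ℕ)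
    [HasExt.{0} (Rep.{0} ℤ G)] :
    Subsingleton (groupCohomology A (n + 1)) ↔
      ∀ e : Ext (Rep.trivial ℤ G ℤ) A (n + 1), e = 0 := by
  let P := Rep.barResolution ℤ G
  rw [← ModuleCat.isZero_iff_subsingleton, (groupCohomologyIso A (n + 1) P).isZero_iff,
    ← HomologicalComplex.exactAt_iff_isZero_homology,
    HomologicalComplex.exactAt_iff' _ n (n + 1) (n + 2) (by simp) (by simp),
    ShortComplex.moduleCat_exact_iff]
  constructor
  · intro h e
    obtain ⟨f, hf, rfl⟩ := P.extMk_surjective e (n + 2) rfl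
    rw [P.extMk_eq_zero_iff f (n + 2) rfl hf n rfl]
    exact h f hf
  · intro h f hf
    exact (P.extMk_eq_zero_iff f (n + 2) rfl hf n rfl).1 (h _)

theorem cohDim_le_iff_hasProjectiveDimensionLE_rep (m : ℕ) :
    cohDim ℤ G ≤ m ↔ HasProjectiveDimensionLE (Rep.trivial.{0} ℤ G ℤ) m := by
  have : HasExt.{0} (Rep.{0} ℤ G) := hasExt_of_enoughProjectives _
  have : EnoughInjectives (Rep.{0} ℤ G) :=
    EnoughInjectives.of_equivalence (Rep.toModuleMonoidAlgebra.{0} (k := ℤ) (G := G))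
  constructor
  · intro h
    refine hasProjectiveDimensionLT_of_enoughInjectives _ _ fun A ↦ ?_
    refine ⟨fun e₁ e₂ ↦ ?_⟩
    have hs : Subsingleton (groupCohomology A (m + 1)) := by
      by_contra hns
      rw [not_subsingleton_iff_nontrivial] at hns
      have h1 : ((m + 1 : ℕ) : ℕ∞) ≤ cohDim ℤ G := le_sSup ⟨m + 1, A, rfl, hns⟩
      have h2 := h1.trans h
      norm_cast at h2
      lia
    rw [subsingleton_groupCohomology_succ_iff] at hs
    rw [hs e₁, hs e₂]
  · intro h
    refine sSup_le ?_
    rintro _ ⟨n, A, rfl, hA⟩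
    by_contra! hn
    norm_cast at hn
    obtain ⟨k, rfl⟩ := Nat.exists_eq_add_of_lt hn
    rw [← not_subsingleton_iff_nontrivial] at hA
    exact hA ((subsingleton_groupCohomology_succ_iff A (m + k)).2 fun e ↦
      e.eq_zero_of_hasProjectiveDimensionLT (m + 1) (by lia))

theorem hasProjectiveDimensionLE_of_isEquivalence {C D : Type*} [Category* C] [Category* D]
    [Abelian C] [Abelian D] [EnoughProjectives C] (F : C ⥤ D) [F.IsEquivalence]
    (X : C) (n : ℕ) (h : HasProjectiveDimensionLE X n) : HasProjectiveDimensionLE (F.obj X) n := by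
  have : F.Additive := F.additive_of_preserves_binary_products
  induction n generalizing X with
  | zero =>
    have hX : Projective X := projective_iff_hasProjectiveDimensionLT_one.2 h
    exact projective_iff_hasProjectiveDimensionLT_one.1
      ((F.asEquivalence.map_projective_iff X).2 hX)
  | succ n ih =>
    let P : ProjectivePresentation X := Classical.arbitrary _
    let S := ShortComplex.mk _ _ (Limits.kernel.condition P.f)
    have hS : S.ShortExact := { exact := ShortComplex.exact_kernel P.f }
    have hF := hS.map_of_exact F
    refine (hF.hasProjectiveDimensionLT_X₃_iff n ?_).2
      (ih _ ((hS.hasProjectiveDimensionLT_X₃_iff n P.projective).1 h))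
    exact (F.asEquivalence.map_projective_iff _).2 P.projective

theorem cohDim_le_iff (m : ℕ) :
    cohDim ℤ G ≤ m ↔
      HasProjectiveDimensionLE (ModuleCat.of (MonoidAlgebra ℤ G) (TrivialZ G)) m := by
  rw [cohDim_le_iff_hasProjectiveDimensionLE_rep]
  constructor
  · exact fun h ↦ hasProjectiveDimensionLE_of_isEquivalence
      (Rep.toModuleMonoidAlgebra.{0} (k := ℤ) (G := G)) _ m h
  · intro h
    have h' := hasProjectiveDimensionLE_of_isEquivalence
      (Rep.ofModuleMonoidAlgebra.{0} (k := ℤ) (G := G)) _ m h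
    exact @hasProjectiveDimensionLT_of_iso _ _ _ _ _
      (Rep.unitIso (Rep.trivial.{0} ℤ G ℤ)).symm (m + 1) h'

end CohomologyAsExt

section ProjectiveDimension

open CategoryTheory

/-- The projective dimension of the `R`-module `M` is at most `n`. -/
def ProjDimLE (R M : Type) [Ring R] [AddCommGroup M] [Module R M] (n : ℕ) : Prop :=
  HasProjectiveDimensionLE (ModuleCat.of R M) n

namespace ProjDimLE

variable {R A B C : Type} [Ring R] [AddCommGroup A] [Module R A] [AddCommGroup B] [Module R B]
  [AddCommGroup C] [Module R C]

theorem zero_iff_projective : ProjDimLE R A 0 ↔ Module.Projective R A := by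
  rw [IsProjective.iff_projective]
  exact projective_iff_hasProjectiveDimensionLT_one.symm

theorem mono {m n : ℕ} (hmn : m ≤ n) (h : ProjDimLE R A m) : ProjDimLE R A n :=
  @hasProjectiveDimensionLT_of_ge _ _ _ _ (m + 1) (n + 1) (by lia) h

theorem of_projective [h : Module.Projective R A] (n : ℕ) : ProjDimLE R A n :=
  mono (Nat.zero_le n) (zero_iff_projective.2 h)

theorem of_semilinearEquiv {R' A' : Type} [Ring R'] [AddCommGroup A'] [Module R' A']
    (e : R ≃+* R') (f : A ≃+ A') (hf : ∀ r a, f (r • a) = e r • f a) {n : ℕ}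
    (h : ProjDimLE R A n) : ProjDimLE R' A' n := by
  let _ := RingHomInvPair.of_ringEquiv e
  let _ := RingHomInvPair.of_ringEquiv e.symm
  let f' : A ≃ₛₗ[RingHomClass.toRingHom e] A' := { f with map_smul' := hf }
  have : HasProjectiveDimensionLE (ModuleCat.of R A) n := h
  exact ModuleCat.hasProjectiveDimensionLE_of_semiLinearEquiv (M := ModuleCat.of R A)
    (N := ModuleCat.of R' A') e f' n

variable {i : A →ₗ[R] B} {p : B →ₗ[R] C}

theorem shortExact_mk (hi : Function.Injective i) (hip : Function.Exact i p)
    (hp : Function.Surjective p) :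
    (ShortComplex.mk (ModuleCat.ofHom i) (ModuleCat.ofHom p)
      (by ext x; exact hip.apply_apply_eq_zero x)).ShortExact where
  exact := (ShortComplex.ShortExact.moduleCat_exact_iff_function_exact _).2 hip
  mono_f := (ModuleCat.mono_iff_injective _).2 hi
  epi_g := (ModuleCat.epi_iff_surjective _).2 hp

theorem left_of_exact (hi : Function.Injective i) (hip : Function.Exact i p)
    (hp : Function.Surjective p) {n : ℕ} (hB : ProjDimLE R B n) (hC : ProjDimLE R C (n + 1)) :
    ProjDimLE R A n :=
  (shortExact_mk hi hip hp).hasProjectiveDimensionLT_X₁ (n + 1) hB hC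

theorem right_of_exact (hi : Function.Injective i) (hip : Function.Exact i p)
    (hp : Function.Surjective p) {n : ℕ} (hA : ProjDimLE R A n) (hB : ProjDimLE R B (n + 1)) :
    ProjDimLE R C (n + 1) :=
  (shortExact_mk hi hip hp).hasProjectiveDimensionLT_X₃ (n + 1) hA hB

end ProjDimLE

end ProjectiveDimension

section ExternalTensorProduct

open TensorProduct

/-- The external tensor product over `ℤ` of an `S`-module and a `T`-module, regarded as a module
over `S ⊗[ℤ] T`. -/
def ExtTensor (S T X Y : Type) [Ring S] [Ring T] [AddCommGroup X] [Module S X]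
    [AddCommGroup Y] [Module T Y] : Type :=
  X ⊗[ℤ] Y

namespace ExtTensor

section Basic

variable {S T X Y X' Y' : Type} [Ring S] [Ring T]
  [AddCommGroup X] [Module S X] [AddCommGroup Y] [Module T Y]
  [AddCommGroup X'] [Module S X'] [AddCommGroup Y'] [Module T Y']

noncomputable instance : AddCommGroup (ExtTensor S T X Y) :=
  inferInstanceAs (AddCommGroup (X ⊗[ℤ] Y))

variable (S T X Y) in
/-- The action of `S ⊗[ℤ] T` on `X ⊗[ℤ] Y`. -/
noncomputable def action : S ⊗[ℤ] T →ₐ[ℤ] Module.End ℤ (X ⊗[ℤ] Y) :=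
  Module.endTensorEndAlgHom.comp
    (Algebra.TensorProduct.map (Algebra.lsmul ℤ ℤ X) (Algebra.lsmul ℤ ℤ Y))

noncomputable instance : Module (S ⊗[ℤ] T) (ExtTensor S T X Y) :=
  Module.compHom (X ⊗[ℤ] Y) (action S T X Y).toRingHom

variable (S T X Y) in
/-- The external tensor product is, additively, the tensor product over `ℤ`. -/
noncomputable def toTensor : ExtTensor S T X Y ≃+ X ⊗[ℤ] Y :=
  AddEquiv.refl _

variable (S T) in
/-- The pure tensors of an external tensor product. -/
noncomputable def tmul (x : X) (y : Y) : ExtTensor S T X Y :=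
  (toTensor S T X Y).symm (x ⊗ₜ[ℤ] y)

theorem toTensor_tmul (x : X) (y : Y) : toTensor S T X Y (tmul S T x y) = x ⊗ₜ[ℤ] y :=
  rfl

theorem smul_tmul (s : S) (t : T) (x : X) (y : Y) :
    (s ⊗ₜ[ℤ] t) • tmul S T x y = tmul S T (s • x) (t • y) :=
  rfl

@[elab_as_elim]
theorem induction_on {motive : ExtTensor S T X Y → Prop} (z : ExtTensor S T X Y)
    (zero : motive 0) (tmul : ∀ x y, motive (tmul S T x y))
    (add : ∀ a b, motive a → motive b → motive (a + b)) : motive z :=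
  TensorProduct.induction_on (motive := motive) z zero tmul add

/-- An additive map out of an external tensor product which is compatible with the action of pure
tensors on pure tensors is linear. -/
noncomputable def linearMapMk {M : Type} [AddCommGroup M] [Module (S ⊗[ℤ] T) M]
    (f : ExtTensor S T X Y →+ M)
    (hf : ∀ (s : S) (t : T) (x : X) (y : Y),
      f (tmul S T (s • x) (t • y)) = (s ⊗ₜ[ℤ] t) • f (tmul S T x y)) :
    ExtTensor S T X Y →ₗ[S ⊗[ℤ] T] M where
  toFun := f
  map_add' := map_add f
  map_smul' e z := by
    rw [RingHom.id_apply]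
    induction e using TensorProduct.induction_on with
    | zero =>
      exact (congrArg f (zero_smul (S ⊗[ℤ] T) z)).trans
        ((map_zero f).trans (zero_smul (S ⊗[ℤ] T) (f z)).symm)
    | add a b ha hb => rw [add_smul, add_smul, map_add, ha, hb]
    | tmul s t =>
      induction z using induction_on with
      | zero => rw [map_zero, smul_zero, smul_zero, map_zero]
      | add a b ha hb => rw [smul_add, map_add, map_add, smul_add, ha, hb]
      | tmul x y => exact hf s t x y

/-- The external tensor product of two linear maps. -/
noncomputable def map (f : X →ₗ[S] X') (g : Y →ₗ[T] Y') :
    ExtTensor S T X Y →ₗ[S ⊗[ℤ] T] ExtTensor S T X' Y' :=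
  linearMapMk ((toTensor S T X' Y').symm.toAddMonoidHom.comp
    ((TensorProduct.map f.toAddMonoidHom.toIntLinearMap
      g.toAddMonoidHom.toIntLinearMap).toAddMonoidHom.comp (toTensor S T X Y).toAddMonoidHom))
    (fun s t x y ↦ by
      change tmul S T (f (s • x)) (g (t • y)) = tmul S T (s • f x) (t • g y)
      rw [map_smul, map_smul])

theorem map_tmul (f : X →ₗ[S] X') (g : Y →ₗ[T] Y') (x : X) (y : Y) :
    map f g (tmul S T x y) = tmul S T (f x) (g y) :=
  rfl

theorem linearMap_ext {M : Type} [AddCommGroup M] [Module (S ⊗[ℤ] T) M]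
    {f g : ExtTensor S T X Y →ₗ[S ⊗[ℤ] T] M}
    (h : ∀ x y, f (tmul S T x y) = g (tmul S T x y)) : f = g := by
  ext z
  induction z using induction_on with
  | zero => rw [map_zero, map_zero]
  | add a b ha hb => rw [map_add, map_add, ha, hb]
  | tmul x y => exact h x y

theorem projDimLE_swap {n : ℕ} (h : ProjDimLE (S ⊗[ℤ] T) (ExtTensor S T X Y) n) :
    ProjDimLE (T ⊗[ℤ] S) (ExtTensor T S Y X) n := by
  refine h.of_semilinearEquiv (Algebra.TensorProduct.comm ℤ S T).toRingEquiv
    ((toTensor S T X Y).trans ((TensorProduct.comm ℤ X Y).toAddEquiv.trans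
      (toTensor T S Y X).symm)) fun r a ↦ ?_
  induction r using TensorProduct.induction_on with
  | zero => rw [zero_smul, map_zero, map_zero, zero_smul]
  | add a b ha hb => rw [add_smul, map_add, ha, hb, map_add, add_smul]
  | tmul s t =>
    induction a using induction_on with
    | zero => rw [smul_zero, map_zero, smul_zero]
    | add a b ha hb => rw [smul_add, map_add, map_add, smul_add, ha, hb]
    | tmul x y => rfl

instance free_finsupp (α β : Type) :
    Module.Free (S ⊗[ℤ] T) (ExtTensor S T (α →₀ S) (β →₀ T)) := by
  classical
  let e : ExtTensor S T (α →₀ S) (β →₀ T) ≃+ (α × β →₀ S ⊗[ℤ] T) :=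
    (toTensor S T _ _).trans (finsuppTensorFinsupp ℤ ℤ S T α β).toAddEquiv
  have he (s : S) (t : T) (x : α →₀ S) (y : β →₀ T) :
      e (tmul S T (s • x) (t • y)) = (s ⊗ₜ[ℤ] t) • e (tmul S T x y) := by
    ext p
    change finsuppTensorFinsupp ℤ ℤ S T α β ((s • x) ⊗ₜ[ℤ] (t • y)) p =
      (s ⊗ₜ[ℤ] t) • finsuppTensorFinsupp ℤ ℤ S T α β (x ⊗ₜ[ℤ] y) p
    obtain ⟨i, j⟩ := p
    simp [finsuppTensorFinsupp_apply]
  exact Module.Free.of_equiv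
    (LinearEquiv.ofBijective (linearMapMk e.toAddMonoidHom he) e.bijective).symm

instance projective [Module.Projective S X] [Module.Projective T Y] :
    Module.Projective (S ⊗[ℤ] T) (ExtTensor S T X Y) := by
  obtain ⟨s, hs⟩ := Module.projective_def.1 ‹Module.Projective S X›
  obtain ⟨t, ht⟩ := Module.projective_def.1 ‹Module.Projective T Y›
  refine Module.Projective.of_split (map s t)
    (map (Finsupp.linearCombination S id) (Finsupp.linearCombination T id))
    (linearMap_ext fun x y ↦ ?_)
  rw [LinearMap.comp_apply, map_tmul, map_tmul, hs, ht, LinearMap.id_apply]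

end Basic

section Exactness

variable {S T A B C Y : Type} [Ring S] [Ring T] [AddCommGroup A] [Module S A]
  [AddCommGroup B] [Module S B] [AddCommGroup C] [Module S C] [AddCommGroup Y] [Module T Y]
  {i : A →ₗ[S] B} {p : B →ₗ[S] C}

theorem map_id_right_injective [Module.Flat ℤ Y] (hi : Function.Injective i) :
    Function.Injective (map i (LinearMap.id (R := T) (M := Y))) :=
  Module.Flat.rTensor_preserves_injective_linearMap (M := Y) i.toAddMonoidHom.toIntLinearMap hi

theorem map_id_left_injective [Module.Flat ℤ Y] (hi : Function.Injective i) :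
    Function.Injective (map (LinearMap.id (R := T) (M := Y)) i) :=
  Module.Flat.lTensor_preserves_injective_linearMap (M := Y) i.toAddMonoidHom.toIntLinearMap hi

theorem map_id_right_exact (hip : Function.Exact i p) (hp : Function.Surjective p) :
    Function.Exact (map i (LinearMap.id (R := T) (M := Y)))
      (map p (LinearMap.id (R := T) (M := Y))) :=
  rTensor_exact Y (f := i.toAddMonoidHom.toIntLinearMap) (g := p.toAddMonoidHom.toIntLinearMap)
    hip hp

theorem map_id_left_exact (hip : Function.Exact i p) (hp : Function.Surjective p) :
    Function.Exact (map (LinearMap.id (R := T) (M := Y)) i)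
      (map (LinearMap.id (R := T) (M := Y)) p) :=
  lTensor_exact Y (f := i.toAddMonoidHom.toIntLinearMap) (g := p.toAddMonoidHom.toIntLinearMap)
    hip hp

theorem map_surjective {A' B' : Type} [AddCommGroup A'] [Module T A'] [AddCommGroup B']
    [Module T B'] {f : A →ₗ[S] B} {g : A' →ₗ[T] B'} (hf : Function.Surjective f)
    (hg : Function.Surjective g) : Function.Surjective (map f g) :=
  TensorProduct.map_surjective (g := f.toAddMonoidHom.toIntLinearMap)
    (g' := g.toAddMonoidHom.toIntLinearMap) hf hg

theorem _root_.Module.Flat.int_of_injective {A B : Type} [AddCommGroup A] [AddCommGroup B]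
    [Module.Flat ℤ B] (f : A →+ B) (hf : Function.Injective f) : Module.Flat ℤ A := by
  have : Module.IsTorsionFree ℤ A := hf.moduleIsTorsionFree f (map_zsmul f)
  infer_instance

theorem _root_.Module.Projective.flat_int [Module.Free ℤ S] [Module.Projective S A] :
    Module.Flat ℤ A := by
  obtain ⟨s, hs⟩ := Module.projective_def.1 ‹Module.Projective S A›
  exact Module.Flat.int_of_injective s.toAddMonoidHom hs.injective

theorem _root_.exists_exact_projective (R A : Type) [Ring R] [AddCommGroup A] [Module R A] :
    ∃ (K F : Type) (_ : AddCommGroup K) (_ : AddCommGroup F) (_ : Module R K) (_ : Module R F)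
      (i : K →ₗ[R] F) (p : F →ₗ[R] A), Module.Projective R F ∧ Function.Injective i ∧
        Function.Exact i p ∧ Function.Surjective p :=
  ⟨LinearMap.ker (Finsupp.linearCombination R (id : A → A)), A →₀ R,
    inferInstance, inferInstance, inferInstance, inferInstance,
    (LinearMap.ker (Finsupp.linearCombination R (id : A → A))).subtype,
    Finsupp.linearCombination R id, inferInstance, Subtype.val_injective,
    LinearMap.exact_subtype_ker_map _, Finsupp.linearCombination_id_surjective R A⟩

theorem projDimLE_of_projective_left [Module.Free ℤ S] [Module.Projective S A] {n : ℕ}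
    (hY : ProjDimLE T Y n) : ProjDimLE (S ⊗[ℤ] T) (ExtTensor S T A Y) n := by
  have := Module.Projective.flat_int (S := S) (A := A)
  induction n generalizing Y with
  | zero =>
    have := ProjDimLE.zero_iff_projective.1 hY
    exact ProjDimLE.of_projective _
  | succ n ih =>
    obtain ⟨K, F, _, _, _, _, i, p, _, hi, hip, hp⟩ := exists_exact_projective T Y
    exact ProjDimLE.right_of_exact (map_id_left_injective (T := S) (Y := A) hi)
      (map_id_left_exact (T := S) (Y := A) hip hp)
      (map_surjective (f := LinearMap.id) Function.surjective_id hp)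
      (ih (ProjDimLE.left_of_exact hi hip hp (ProjDimLE.of_projective _) hY))
      (ProjDimLE.of_projective _)

theorem projDimLE_add [Module.Free ℤ S] [Module.Flat ℤ Y] {m n : ℕ}
    (hA : ProjDimLE S A m) (hY : ProjDimLE T Y n) :
    ProjDimLE (S ⊗[ℤ] T) (ExtTensor S T A Y) (m + n) := by
  induction m generalizing A with
  | zero =>
    have := ProjDimLE.zero_iff_projective.1 hA
    exact (projDimLE_of_projective_left hY).mono (Nat.le_add_left _ _)
  | succ m ih =>
    obtain ⟨K, F, _, _, _, _, i, p, _, hi, hip, hp⟩ := exists_exact_projective S A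
    rw [Nat.add_right_comm]
    exact ProjDimLE.right_of_exact (map_id_right_injective (T := T) (Y := Y) hi)
      (map_id_right_exact (T := T) (Y := Y) hip hp)
      (map_surjective (g := LinearMap.id) hp Function.surjective_id)
      (ih (ProjDimLE.left_of_exact hi hip hp (ProjDimLE.of_projective _) hA))
      ((projDimLE_of_projective_left hY).mono (by lia))

end Exactness

end ExtTensor

end ExternalTensorProduct

section FiniteResolution

/-- `M` admits a resolution of length at most `n` by finitely generated projective modules. -/
def HasFiniteResolution (R : Type) [Ring R] :
    ℕ → ∀ (M : Type) [AddCommGroup M] [Module R M], Prop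
  | 0, M, _, _ => Module.Finite R M ∧ Module.Projective R M
  | n + 1, M, _, _ =>
    ∃ (K F : Type) (_ : AddCommGroup K) (_ : AddCommGroup F) (_ : Module R K) (_ : Module R F)
      (i : K →ₗ[R] F) (p : F →ₗ[R] M), Module.Finite R F ∧ Module.Projective R F ∧
        Function.Injective i ∧ Function.Exact i p ∧ Function.Surjective p ∧
        HasFiniteResolution R n K

namespace HasFiniteResolution

variable {R M : Type} [Ring R] [AddCommGroup M] [Module R M]

theorem finite {n : ℕ} (h : HasFiniteResolution R n M) : Module.Finite R M := by
  cases n with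
  | zero => exact h.1
  | succ n =>
    obtain ⟨K, F, _, _, _, _, i, p, _, _, _, _, hp, _⟩ := h
    exact Module.Finite.of_surjective p hp

theorem projDimLE {n : ℕ} (h : HasFiniteResolution R n M) : ProjDimLE R M n := by
  induction n generalizing M with
  | zero => exact ProjDimLE.zero_iff_projective.2 h.2
  | succ n ih =>
    obtain ⟨K, F, _, _, _, _, i, p, _, _, hi, hip, hp, hK⟩ := h
    exact ProjDimLE.right_of_exact hi hip hp (ih hK) (ProjDimLE.of_projective _)

theorem of_exact_sequence (N : ℕ) (C : ℕ → Type) [∀ n, AddCommGroup (C n)]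
    [∀ n, Module R (C n)] [∀ n, Module.Projective R (C n)] [∀ n, Module.Finite R (C n)]
    (hC : ∀ n, N < n → Subsingleton (C n)) (d : ∀ n, C (n + 1) →ₗ[R] C n) (ε : C 0 →ₗ[R] M)
    (hε : Function.Surjective ε) (h₀ : LinearMap.range (d 0) = LinearMap.ker ε)
    (h : ∀ n, LinearMap.range (d (n + 1)) = LinearMap.ker (d n)) :
    HasFiniteResolution R N M := by
  induction N generalizing C M with
  | zero =>
    have := hC 1 Nat.one_pos
    have hinj : Function.Injective ε := by
      rw [← LinearMap.ker_eq_bot, ← h₀, LinearMap.range_eq_bot]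
      exact Subsingleton.elim _ _
    let e := LinearEquiv.ofBijective ε ⟨hinj, hε⟩
    exact ⟨Module.Finite.equiv e, Module.Projective.of_equiv e⟩
  | succ N ih =>
    refine ⟨LinearMap.ker ε, C 0, inferInstance, inferInstance, inferInstance, inferInstance,
      (LinearMap.ker ε).subtype, ε, inferInstance, inferInstance, Subtype.val_injective,
      LinearMap.exact_subtype_ker_map ε, hε, ?_⟩
    have hmem (x : C 1) : d 0 x ∈ LinearMap.ker ε := h₀ ▸ LinearMap.mem_range_self (d 0) x
    refine ih (fun n ↦ C (n + 1)) (fun n hn ↦ hC (n + 1) (by lia)) (fun n ↦ d (n + 1))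
      ((d 0).codRestrict _ hmem) ?_ ?_ (fun n ↦ h (n + 1))
    · rintro ⟨x, hx⟩
      obtain ⟨y, rfl⟩ : x ∈ LinearMap.range (d 0) := h₀ ▸ hx
      exact ⟨y, rfl⟩
    · rw [LinearMap.ker_codRestrict]
      exact h 0

open TensorProduct in
theorem exists_syzygy {S T : Type} [Ring S] [Ring T] [Module.Free ℤ S] {X : Type}
    [AddCommGroup X] [Module S X] [Module.Flat ℤ X] {N n : ℕ} (hX : HasFiniteResolution S N X)
    (hle : ProjDimLE S X (n + 1)) (hlt : ¬ ProjDimLE S X n) :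
    ∃ (K P Q : Type) (_ : AddCommGroup K) (_ : AddCommGroup P) (_ : AddCommGroup Q)
      (_ : Module S K) (_ : Module S P) (_ : Module S Q) (i : Q →ₗ[S] P) (p : P →ₗ[S] K),
      Module.Flat ℤ K ∧ Module.Finite S P ∧ Module.Finite S Q ∧ Module.Projective S P ∧
      Module.Projective S Q ∧ Function.Injective i ∧ Function.Exact i p ∧
      Function.Surjective p ∧ (¬ ∃ r : P →ₗ[S] Q, r ∘ₗ i = LinearMap.id) ∧
      ∀ (Y : Type) [AddCommGroup Y] [Module T Y] [Module.Flat ℤ Y] (b : ℕ),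
        ProjDimLE T Y (b + 1) → ProjDimLE (S ⊗[ℤ] T) (ExtTensor S T X Y) (n + b + 1) →
        ProjDimLE (S ⊗[ℤ] T) (ExtTensor S T K Y) (b + 1) := by
  induction n generalizing N X with
  | zero =>
    cases N with
    | zero => exact absurd hX.projDimLE hlt
    | succ N =>
      obtain ⟨Q, P, _, _, _, _, i, p, _, _, hi, hip, hp, hQ⟩ := hX
      have : Module.Finite S Q := hQ.finite
      have : Module.Projective S Q := ProjDimLE.zero_iff_projective.1
        (ProjDimLE.left_of_exact hi hip hp (ProjDimLE.of_projective _) hle)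
      refine ⟨X, P, Q, _, _, _, _, _, _, i, p, ‹_›, ‹_›, ‹_›, ‹_›, ‹_›, hi, hip, hp, ?_, ?_⟩
      · rintro ⟨r, hr⟩
        obtain ⟨s, hs⟩ : ∃ s, p ∘ₗ s = LinearMap.id :=
          ((hip.split_tfae hi hp).out 1 0).1 (Exists.intro r hr)
        exact hlt (ProjDimLE.zero_iff_projective.2 (Module.Projective.of_split s p hs))
      · intro Y _ _ _ b _ h
        rwa [Nat.zero_add] at h
  | succ n ih =>
    cases N with
    | zero => exact absurd (hX.projDimLE.mono (Nat.zero_le _)) hlt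
    | succ N =>
      obtain ⟨X₁, F, _, _, _, _, j, q, _, _, hj, hjq, hq, hX₁⟩ := hX
      have := Module.Projective.flat_int (S := S) (A := F)
      have := Module.Flat.int_of_injective j.toAddMonoidHom hj
      obtain ⟨K, P, Q, _, _, _, _, _, _, i, p, h₁, h₂, h₃, h₄, h₅, hi, hip, hp, hr, h⟩ := ih hX₁
        (ProjDimLE.left_of_exact hj hjq hq (ProjDimLE.of_projective _) hle)
        (fun h ↦ hlt (ProjDimLE.right_of_exact hj hjq hq h (ProjDimLE.of_projective _)))
      refine ⟨K, P, Q, _, _, _, _, _, _, i, p, h₁, h₂, h₃, h₄, h₅, hi, hip, hp, hr, ?_⟩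
      intro Y _ _ _ b hY hXY
      refine h Y b hY (ProjDimLE.left_of_exact
        (ExtTensor.map_id_right_injective (T := T) (Y := Y) hj)
        (ExtTensor.map_id_right_exact (T := T) (Y := Y) hjq hq)
        (ExtTensor.map_surjective (g := LinearMap.id) hq Function.surjective_id)
        ((ExtTensor.projDimLE_of_projective_left hY).mono (by lia)) ?_)
      rwa [show n + b + 1 + 1 = n + 1 + b + 1 by lia]

end HasFiniteResolution

end FiniteResolution

section Functional

theorem Module.Dual.exists_apply_ne_zero (F : Type) {V : Type} [Field F] [AddCommGroup V]
    [Module F V] {v : V} (hv : v ≠ 0) : ∃ f : Module.Dual F V, f v ≠ 0 := by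
  by_contra! h
  exact hv ((Module.forall_dual_apply_eq_zero_iff F v).1 h)

theorem Ideal.exists_field_functional {A : Type} [Ring A] (I : Ideal A) (hI : (1 : A) ∉ I) :
    ∃ (F : Type) (_ : Field F) (l : A →+ F), (∀ a ∈ I, l a = 0) ∧ l 1 ≠ 0 := by
  classical
  obtain ⟨J, hJ, hIJ⟩ := I.exists_le_maximal ((Ideal.ne_top_iff_one I).2 hI)
  have : IsSimpleModule A (A ⧸ J) := isSimpleModule_iff_isCoatom.2 hJ.out
  have h1 : J.mkQ 1 ≠ 0 := fun h ↦ hJ.ne_top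
    ((Ideal.eq_top_iff_one J).2 ((Submodule.Quotient.mk_eq_zero J).1 h))
  let _ : Module (Subring.center (Module.End A (A ⧸ J))) (A ⧸ J) :=
    Module.compHom _ (Subring.center (Module.End A (A ⧸ J))).subtype
  obtain ⟨f, hf⟩ := Module.Dual.exists_apply_ne_zero (Subring.center (Module.End A (A ⧸ J))) h1
  refine ⟨Subring.center (Module.End A (A ⧸ J)), inferInstance,
    f.toAddMonoidHom.comp J.mkQ.toAddMonoidHom, fun a ha ↦ ?_, hf⟩
  change f (J.mkQ a) = 0
  rw [Submodule.mkQ_apply, (Submodule.Quotient.mk_eq_zero J).2 (hIJ ha), map_zero]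

theorem Module.Projective.exists_dual_basis (S P : Type) [Ring S] [AddCommGroup P] [Module S P]
    [Module.Finite S P] [Module.Projective S P] :
    ∃ (n : ℕ) (x : Fin n → P) (c : Fin n → P →ₗ[S] S), ∀ y, ∑ a, c a y • x a = y := by
  obtain ⟨n, f, hf⟩ := Module.Finite.exists_fin' S P
  obtain ⟨g, hg⟩ := Module.projective_lifting_property f LinearMap.id hf
  refine ⟨n, fun a ↦ f (Pi.single a 1), fun a ↦ LinearMap.proj a ∘ₗ g, fun y ↦ ?_⟩
  have hy : f (g y) = y := LinearMap.congr_fun hg y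
  conv_rhs => rw [← hy, ← Finset.univ_sum_single (g y), map_sum]
  refine Finset.sum_congr rfl fun a _ ↦ ?_
  rw [LinearMap.comp_apply, LinearMap.proj_apply, ← map_smul, ← Pi.single_smul, smul_eq_mul,
    mul_one]

end Functional

namespace ExtTensor

open TensorProduct

variable {S T P Q M N : Type} [Ring S] [Ring T] [AddCommGroup P] [Module S P]
  [AddCommGroup Q] [Module T Q] [AddCommGroup M] [Module S M] [AddCommGroup N] [Module T N]

theorem mem_closure_range_map [Module.Finite S P] [Module.Projective S P] [Module.Finite T Q]
    [Module.Projective T Q] (φ : ExtTensor S T P Q →ₗ[S ⊗[ℤ] T] ExtTensor S T M N) :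
    φ ∈ AddSubgroup.closure
      (Set.range fun fg : (P →ₗ[S] M) × (Q →ₗ[T] N) ↦ map fg.1 fg.2) := by
  obtain ⟨m, x, c, hc⟩ := Module.Projective.exists_dual_basis S P
  obtain ⟨n, y, d, hd⟩ := Module.Projective.exists_dual_basis T Q
  have key (a : Fin m) (b : Fin n) (z : ExtTensor S T M N) : ∃ θ ∈ AddSubgroup.closure
      (Set.range fun fg : (P →ₗ[S] M) × (Q →ₗ[T] N) ↦ map fg.1 fg.2),
      ∀ u v, θ (tmul S T u v) = (c a u ⊗ₜ[ℤ] d b v) • z := by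
    induction z using induction_on with
    | zero => exact ⟨0, zero_mem _, fun u v ↦ (smul_zero _).symm⟩
    | add z w hz hw =>
      obtain ⟨θ, hθ, h⟩ := hz
      obtain ⟨θ', hθ', h'⟩ := hw
      exact ⟨θ + θ', add_mem hθ hθ', fun u v ↦ by rw [LinearMap.add_apply, h, h', smul_add]⟩
    | tmul e f =>
      exact ⟨_, AddSubgroup.subset_closure ⟨((c a).smulRight e, (d b).smulRight f), rfl⟩,
        fun u v ↦ rfl⟩
  choose θ hθ h using fun a b ↦ key a b (φ (tmul S T (x a) (y b)))
  suffices φ = ∑ a, ∑ b, θ a b from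
    this ▸ sum_mem fun a _ ↦ sum_mem fun b _ ↦ hθ a b
  refine linearMap_ext fun u v ↦ ?_
  have huv : tmul S T u v = ∑ a, ∑ b, (c a u ⊗ₜ[ℤ] d b v) • tmul S T (x a) (y b) := by
    calc tmul S T u v = tmul S T (∑ a, c a u • x a) (∑ b, d b v • y b) := by rw [hc, hd]
      _ = ∑ a, ∑ b, tmul S T (c a u • x a) (d b v • y b) := by
        apply (toTensor S T P Q).injective
        simp only [map_sum, toTensor_tmul, TensorProduct.sum_tmul, TensorProduct.tmul_sum]
        exact Finset.sum_comm
  refine (congrArg φ huv).trans ?_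
  simp only [map_sum, LinearMap.sum_apply]
  exact Finset.sum_congr rfl fun a _ ↦ Finset.sum_congr rfl fun b _ ↦
    (map_smul φ _ _).trans (h a b u v).symm

theorem exists_functional_map [Module.Finite S P] [Module.Projective S P] [Module.Finite T Q]
    [Module.Projective T Q] {F : Type} [Field F] (l : (P →ₗ[S] M) →+ F) (l' : (Q →ₗ[T] N) →+ F) :
    ∃ L : (ExtTensor S T P Q →ₗ[S ⊗[ℤ] T] ExtTensor S T M N) →+ F,
      ∀ f g, L (map f g) = l f * l' g := by
  obtain ⟨m, x, c, hc⟩ := Module.Projective.exists_dual_basis S P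
  obtain ⟨n, y, d, hd⟩ := Module.Projective.exists_dual_basis T Q
  let ι (a : Fin m) : M →+ F := l.comp
    { toFun := fun e ↦ (c a).smulRight e
      map_zero' := by ext; simp
      map_add' := fun _ _ ↦ by ext; simp }
  let ι' (b : Fin n) : N →+ F := l'.comp
    { toFun := fun e ↦ (d b).smulRight e
      map_zero' := by ext; simp
      map_add' := fun _ _ ↦ by ext; simp }
  let Λ (a : Fin m) (b : Fin n) : ExtTensor S T M N →+ F :=
    (LinearMap.mul' ℤ F ∘ₗ TensorProduct.map (ι a).toIntLinearMap
      (ι' b).toIntLinearMap).toAddMonoidHom.comp (toTensor S T M N).toAddMonoidHom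
  have hΛ (a b e f) : Λ a b (tmul S T e f) = ι a e * ι' b f := rfl
  refine ⟨∑ a, ∑ b, (Λ a b).comp
    { toFun := fun φ ↦ φ (tmul S T (x a) (y b))
      map_zero' := rfl
      map_add' := fun _ _ ↦ rfl }, fun f g ↦ ?_⟩
  have hf : ∑ a, ι a (f (x a)) = l f := by
    refine (map_sum l _ _).symm.trans (congrArg l (LinearMap.ext fun u ↦ ?_))
    conv_rhs => rw [← hc u]
    simp [LinearMap.sum_apply]
  have hg : ∑ b, ι' b (g (y b)) = l' g := by
    refine (map_sum l' _ _).symm.trans (congrArg l' (LinearMap.ext fun u ↦ ?_))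
    conv_rhs => rw [← hd u]
    simp [LinearMap.sum_apply]
  rw [← hf, ← hg, Finset.sum_mul_sum]
  simp only [AddMonoidHom.finsetSum_apply]
  rfl

end ExtTensor

namespace ExtTensor

open TensorProduct

section Split

/-- Given a commutative square `A → B → D`, `A → C → D` of injections, in which `B / A` embeds in
`D / C` with cokernel `E`, if `D` is projective and `E` has projective dimension at most `1`, then
the inclusion of `A` in `B × C` splits. -/
theorem _root_.ProjDimLE.exists_split {R A B C D E G H : Type} [Ring R] [AddCommGroup A]
    [Module R A] [AddCommGroup B] [Module R B] [AddCommGroup C] [Module R C] [AddCommGroup D]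
    [Module R D] [AddCommGroup E] [Module R E] [AddCommGroup G] [Module R G] [AddCommGroup H]
    [Module R H] {α : A →ₗ[R] B} {β : A →ₗ[R] C} {γ : B →ₗ[R] D} {δ : C →ₗ[R] D}
    {q : B →ₗ[R] G} {q' : D →ₗ[R] H} {j : G →ₗ[R] H} {r : H →ₗ[R] E}
    (hsq : ∀ x, γ (α x) = δ (β x)) (hsq' : ∀ x, j (q x) = q' (γ x))
    (hα : Function.Injective α) (hδ : Function.Injective δ) (hj : Function.Injective j)
    (hαq : Function.Exact α q) (hδq : Function.Exact δ q') (hjr : Function.Exact j r)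
    (hq : Function.Surjective q) (hq' : Function.Surjective q') (hr : Function.Surjective r)
    [Module.Projective R D] (hE : ProjDimLE R E 1) :
    ∃ (a : B →ₗ[R] A) (b : C →ₗ[R] A), ∀ w, a (α w) + b (β w) = w := by
  have hL : ProjDimLE R (LinearMap.ker (r ∘ₗ q')) 0 :=
    ProjDimLE.left_of_exact (i := (LinearMap.ker (r ∘ₗ q')).subtype) Subtype.val_injective
      (LinearMap.exact_subtype_ker_map (r ∘ₗ q')) (hr.comp hq') (ProjDimLE.of_projective 0) hE
  have := ProjDimLE.zero_iff_projective.1 hL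
  have hσ (z : B × C) : γ.coprod δ z ∈ LinearMap.ker (r ∘ₗ q') := by
    rw [LinearMap.mem_ker, LinearMap.coprod_apply, LinearMap.comp_apply, map_add, ← hsq',
      hδq.apply_apply_eq_zero, add_zero, hjr.apply_apply_eq_zero]
  have hκ : Function.Injective (α.prod (-β)) := fun x y h ↦ hα (congrArg Prod.fst h)
  have hσ' : Function.Surjective ((γ.coprod δ).codRestrict _ hσ) := by
    rintro ⟨z, hz⟩
    obtain ⟨g, hg⟩ := (hjr (q' z)).1 hz
    obtain ⟨x, rfl⟩ := hq g
    obtain ⟨y, hy⟩ := (hδq (z - γ x)).1 (by rw [map_sub, ← hsq', hg, sub_self])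
    exact ⟨(x, y), Subtype.ext ((congrArg (γ x + ·) hy).trans (add_sub_cancel _ _))⟩
  have hκσ : Function.Exact (α.prod (-β)) ((γ.coprod δ).codRestrict _ hσ) := by
    rintro ⟨x, y⟩
    constructor
    · intro h
      replace h : γ x + δ y = 0 := congrArg Subtype.val h
      obtain ⟨w, rfl⟩ := (hαq x).1 (hj (by
        rw [hsq', eq_neg_of_add_eq_zero_left h, map_neg, hδq.apply_apply_eq_zero, neg_zero,
          map_zero]))
      refine ⟨w, Prod.ext rfl (hδ ?_)⟩
      change δ (-β w) = δ y
      rw [map_neg, ← hsq, eq_neg_of_add_eq_zero_right h]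
    · rintro ⟨w, hw⟩
      rw [← hw]
      refine Subtype.ext ?_
      change γ (α w) + δ (-β w) = 0
      rw [map_neg, hsq, add_neg_cancel]
  obtain ⟨s, hs⟩ := Module.projective_lifting_property _ LinearMap.id hσ'
  obtain ⟨l, hl⟩ : ∃ l, l ∘ₗ α.prod (-β) = LinearMap.id :=
    ((hκσ.split_tfae hκ hσ').out 0 1).1 (Exists.intro s hs)
  refine ⟨l ∘ₗ LinearMap.inl R B C, -(l ∘ₗ LinearMap.inr R B C), fun w ↦ ?_⟩
  have hw : l (α w, -β w) = w := LinearMap.congr_fun hl w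
  rw [LinearMap.neg_apply, ← map_neg, LinearMap.comp_apply, LinearMap.comp_apply, ← map_add]
  simpa using hw

variable {S T P Q K P' Q' K' : Type} [Ring S] [Ring T]
  [AddCommGroup P] [Module S P] [AddCommGroup Q] [Module S Q] [AddCommGroup K] [Module S K]
  [AddCommGroup P'] [Module T P'] [AddCommGroup Q'] [Module T Q'] [AddCommGroup K'] [Module T K']
  {i : Q →ₗ[S] P} {p : P →ₗ[S] K} {i' : Q' →ₗ[T] P'} {p' : P' →ₗ[T] K'}

theorem map_id_id (z : ExtTensor S T P P') : map LinearMap.id LinearMap.id z = z := by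
  induction z using induction_on with
  | zero => exact map_zero _
  | tmul x y => rfl
  | add a b ha hb => rw [map_add, ha, hb]

theorem map_id_comm (f : Q →ₗ[S] P) (g : Q' →ₗ[T] P') (z : ExtTensor S T Q Q') :
    map f LinearMap.id (map LinearMap.id g z) = map LinearMap.id g (map f LinearMap.id z) := by
  induction z using induction_on with
  | zero => simp only [map_zero]
  | tmul x y => rfl
  | add a b ha hb => simp only [map_add, ha, hb]

/-- For short exact sequences `0 → Q → P → K → 0` and `0 → Q' → P' → K' → 0` with
`P ⊗ P'` and `K ⊗ K'` of projective dimension at most `0` and `1`, the inclusion of `Q ⊗ Q'` in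
`(Q ⊗ P') × (P ⊗ Q')` splits. -/
theorem exists_split [Module.Flat ℤ P] [Module.Flat ℤ K'] (hi : Function.Injective i)
    (hip : Function.Exact i p) (hp : Function.Surjective p) (hi' : Function.Injective i')
    (hip' : Function.Exact i' p') (hp' : Function.Surjective p')
    [Module.Projective (S ⊗[ℤ] T) (ExtTensor S T P P')]
    (hKK : ProjDimLE (S ⊗[ℤ] T) (ExtTensor S T K K') 1) :
    ∃ (a : ExtTensor S T Q P' →ₗ[S ⊗[ℤ] T] ExtTensor S T Q Q')
      (b : ExtTensor S T P Q' →ₗ[S ⊗[ℤ] T] ExtTensor S T Q Q'),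
      ∀ w, a (map LinearMap.id i' w) + b (map i LinearMap.id w) = w := by
  have := Module.Flat.int_of_injective i.toAddMonoidHom hi
  exact ProjDimLE.exists_split (map_id_comm i i') (map_id_comm i p') (map_id_left_injective hi')
    (map_id_left_injective hi') (map_id_right_injective hi)
    (map_id_left_exact (T := S) (Y := Q) hip' hp') (map_id_left_exact (T := S) (Y := P) hip' hp')
    (map_id_right_exact (T := T) (Y := K') hip hp)
    (map_surjective (f := LinearMap.id) Function.surjective_id hp')
    (map_surjective (f := LinearMap.id) Function.surjective_id hp')
    (map_surjective (g := LinearMap.id) hp Function.surjective_id) hKK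

end Split

theorem exists_retraction {S P Q K : Type} [Ring S] [Module.Free ℤ S]
    [AddCommGroup P] [Module S P] [AddCommGroup Q] [Module S Q] [AddCommGroup K] [Module S K]
    [Module.Finite S P] [Module.Projective S P] [Module.Finite S Q] [Module.Projective S Q]
    [Module.Flat ℤ K] {i : Q →ₗ[S] P} {p : P →ₗ[S] K} (hi : Function.Injective i)
    (hip : Function.Exact i p) (hp : Function.Surjective p)
    (hKK : ProjDimLE (S ⊗[ℤ] S) (ExtTensor S S K K) 1) :
    ∃ r : P →ₗ[S] Q, r ∘ₗ i = LinearMap.id := by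
  have := Module.Projective.flat_int (S := S) (A := P)
  obtain ⟨a, b, hab⟩ := exists_split hi hip hp hi hip hp hKK
  let I : Ideal (Module.End S Q) :=
    { carrier := Set.range fun r : P →ₗ[S] Q ↦ r ∘ₗ i
      zero_mem' := ⟨0, LinearMap.zero_comp i⟩
      add_mem' := by
        rintro _ _ ⟨r, rfl⟩ ⟨s, rfl⟩
        exact ⟨r + s, LinearMap.add_comp _ _ _⟩
      smul_mem' := by
        rintro f _ ⟨r, rfl⟩
        exact ⟨f ∘ₗ r, rfl⟩ }
  by_contra hr
  obtain ⟨F, _, l, hl, hl1⟩ := I.exists_field_functional hr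
  obtain ⟨L, hL⟩ := exists_functional_map (P := Q) (Q := Q) (M := Q) (N := Q) l l
  have ha (a : ExtTensor S S Q P →ₗ[S ⊗[ℤ] S] ExtTensor S S Q Q) :
      L (a ∘ₗ map LinearMap.id i) = 0 := by
    induction mem_closure_range_map a using AddSubgroup.closure_induction with
    | mem x h =>
      obtain ⟨⟨f, g⟩, rfl⟩ := h
      have : map f g ∘ₗ map LinearMap.id i = map f (g ∘ₗ i) :=
        linearMap_ext fun _ _ ↦ rfl
      rw [this, hL, hl (g ∘ₗ i) ⟨g, rfl⟩, mul_zero]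
    | zero => rw [LinearMap.zero_comp, map_zero]
    | add x y _ _ hx hy => rw [LinearMap.add_comp, map_add, hx, hy, add_zero]
    | neg x _ hx => rw [LinearMap.neg_comp, map_neg, hx, neg_zero]
  have hb (b : ExtTensor S S P Q →ₗ[S ⊗[ℤ] S] ExtTensor S S Q Q) :
      L (b ∘ₗ map i LinearMap.id) = 0 := by
    induction mem_closure_range_map b using AddSubgroup.closure_induction with
    | mem x h =>
      obtain ⟨⟨f, g⟩, rfl⟩ := h
      have : map f g ∘ₗ map i LinearMap.id = map (f ∘ₗ i) g :=
        linearMap_ext fun _ _ ↦ rfl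
      rw [this, hL, hl (f ∘ₗ i) ⟨f, rfl⟩, zero_mul]
    | zero => rw [LinearMap.zero_comp, map_zero]
    | add x y _ _ hx hy => rw [LinearMap.add_comp, map_add, hx, hy, add_zero]
    | neg x _ hx => rw [LinearMap.neg_comp, map_neg, hx, neg_zero]
  have hsum : a ∘ₗ map LinearMap.id i + b ∘ₗ map i LinearMap.id = map LinearMap.id LinearMap.id :=
    LinearMap.ext fun w ↦ (hab w).trans (map_id_id w).symm
  have h1 : l 1 * l 1 = 0 := (hL 1 1).symm.trans (by
    rw [Module.End.one_eq_id, ← hsum, map_add, ha, hb, add_zero])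
  exact hl1 (mul_self_eq_zero.1 h1)

end ExtTensor

section Product

open TensorProduct

variable (G H : Type) [Group G] [Group H]

/-- The group ring of a product is the tensor product of the group rings. -/
noncomputable def MonoidAlgebra.tensorAlgEquiv :
    MonoidAlgebra ℤ G ⊗[ℤ] MonoidAlgebra ℤ H ≃ₐ[ℤ] MonoidAlgebra ℤ (G × H) :=
  Algebra.TensorProduct.algEquivOfLinearEquivTensorProduct (MonoidAlgebra.tensorEquiv ℤ)
    (fun a₁ a₂ b₁ b₂ ↦ by
      induction a₁ using MonoidAlgebra.induction_linear with
      | zero => simp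
      | add x y hx hy => simp only [add_mul, TensorProduct.add_tmul, map_add, hx, hy]
      | single =>
      induction a₂ using MonoidAlgebra.induction_linear with
      | zero => simp
      | add x y hx hy => simp only [mul_add, TensorProduct.add_tmul, map_add, hx, hy]
      | single =>
      induction b₁ using MonoidAlgebra.induction_linear with
      | zero => simp
      | add x y hx hy => simp only [add_mul, TensorProduct.tmul_add, map_add, hx, hy]
      | single =>
      induction b₂ using MonoidAlgebra.induction_linear with
      | zero => simp
      | add x y hx hy => simp only [mul_add, TensorProduct.tmul_add, map_add, hx, hy]
      | single =>
        simp only [MonoidAlgebra.single_mul_single, MonoidAlgebra.tensorEquiv_single_tmul_single,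
          Prod.mk_mul_mk, mul_mul_mul_comm])
    (by simp only [MonoidAlgebra.one_def, MonoidAlgebra.tensorEquiv_single_tmul_single, mul_one]
        rfl)

/-- The trivial module of a product is the external tensor product of the trivial modules. -/
noncomputable def trivialZProdEquiv :
    ExtTensor (MonoidAlgebra ℤ G) (MonoidAlgebra ℤ H) (TrivialZ G) (TrivialZ H) ≃+
      TrivialZ (G × H) :=
  (ExtTensor.toTensor _ _ _ _).trans (((TensorProduct.lid ℤ ℤ).toAddEquiv :
    (ℤ ⊗[ℤ] ℤ ≃+ ℤ)).trans (Representation.asModuleEquiv _).symm.toAddEquiv)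

variable {G} in
theorem TrivialZ.single_smul (g : G) (a : ℤ) (x : TrivialZ G) :
    MonoidAlgebra.single g a • x = (a * (show ℤ from x) : ℤ) :=
  Representation.single_smul _ a g x

theorem trivialZProdEquiv_smul (r : MonoidAlgebra ℤ G ⊗[ℤ] MonoidAlgebra ℤ H)
    (a : ExtTensor (MonoidAlgebra ℤ G) (MonoidAlgebra ℤ H) (TrivialZ G) (TrivialZ H)) :
    trivialZProdEquiv G H (r • a) =
      MonoidAlgebra.tensorAlgEquiv G H r • trivialZProdEquiv G H a := by
  have h₀ (a : ExtTensor (MonoidAlgebra ℤ G) (MonoidAlgebra ℤ H) (TrivialZ G) (TrivialZ H)) :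
      trivialZProdEquiv G H ((0 : MonoidAlgebra ℤ G ⊗[ℤ] MonoidAlgebra ℤ H) • a) =
        MonoidAlgebra.tensorAlgEquiv G H 0 • trivialZProdEquiv G H a := by
    exact (congrArg _ (zero_smul (MonoidAlgebra ℤ G ⊗[ℤ] MonoidAlgebra ℤ H) a)).trans
      (by rw [map_zero, map_zero, zero_smul])
  induction r using TensorProduct.induction_on with
  | zero => exact h₀ a
  | add x y hx hy => rw [add_smul, map_add, hx, hy, map_add, add_smul]
  | tmul s t =>
    induction a using ExtTensor.induction_on with
    | zero => rw [smul_zero, map_zero, smul_zero]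
    | add x y hx hy => rw [smul_add, map_add, map_add, smul_add, hx, hy]
    | tmul x y =>
      induction s using MonoidAlgebra.induction_linear with
      | zero => rw [TensorProduct.zero_tmul]; exact h₀ _
      | add s₁ s₂ h₁ h₂ => rw [TensorProduct.add_tmul, add_smul, map_add, h₁, h₂, map_add, add_smul]
      | single g c =>
      induction t using MonoidAlgebra.induction_linear with
      | zero => rw [TensorProduct.tmul_zero]; exact h₀ _
      | add s₁ s₂ h₁ h₂ => rw [TensorProduct.tmul_add, add_smul, map_add, h₁, h₂, map_add, add_smul]
      | single h d =>
        rw [ExtTensor.smul_tmul]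
        change _ = MonoidAlgebra.tensorEquiv ℤ
          (MonoidAlgebra.single g c ⊗ₜ[ℤ] MonoidAlgebra.single h d) • _
        rw [MonoidAlgebra.tensorEquiv_single_tmul_single, TrivialZ.single_smul,
          TrivialZ.single_smul, TrivialZ.single_smul]
        exact mul_mul_mul_comm c _ d _

theorem projDimLE_trivialZ_prod_iff (n : ℕ) :
    ProjDimLE (MonoidAlgebra ℤ (G × H)) (TrivialZ (G × H)) n ↔
      ProjDimLE (MonoidAlgebra ℤ G ⊗[ℤ] MonoidAlgebra ℤ H)
        (ExtTensor (MonoidAlgebra ℤ G) (MonoidAlgebra ℤ H) (TrivialZ G) (TrivialZ H)) n := by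
  refine ⟨fun h ↦ h.of_semilinearEquiv (MonoidAlgebra.tensorAlgEquiv G H).symm.toRingEquiv
      (trivialZProdEquiv G H).symm fun r a ↦ ?_,
    fun h ↦ h.of_semilinearEquiv (MonoidAlgebra.tensorAlgEquiv G H).toRingEquiv
      (trivialZProdEquiv G H) (trivialZProdEquiv_smul G H)⟩
  apply (trivialZProdEquiv G H).injective
  rw [trivialZProdEquiv_smul, AddEquiv.apply_symm_apply, AddEquiv.apply_symm_apply]
  congr 1
  exact ((MonoidAlgebra.tensorAlgEquiv G H).apply_symm_apply r).symm

end Product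

theorem cohDim_prod_self {G : Type} [Group G] {N : ℕ}
    (hG : HasFiniteResolution (MonoidAlgebra ℤ G) N (TrivialZ G)) :
    cohDim ℤ (G × G) = 2 * cohDim ℤ G := by
  have hfree : Module.Free ℤ (MonoidAlgebra ℤ G) := inferInstance
  have hflat : Module.Flat ℤ (TrivialZ G) := inferInstanceAs (Module.Flat ℤ ℤ)
  obtain ⟨n, hn⟩ : ∃ n : ℕ, cohDim ℤ G = n :=
    ENat.ne_top_iff_exists.1 (ne_top_of_le_ne_top (ENat.natCast_ne_top N)
      ((cohDim_le_iff N).2 hG.projDimLE)) |>.imp fun _ h ↦ h.symm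
  have hle : ProjDimLE (MonoidAlgebra ℤ G) (TrivialZ G) n := (cohDim_le_iff n).1 hn.le
  have hupper : cohDim ℤ (G × G) ≤ 2 * cohDim ℤ G := by
    rw [hn, two_mul, ← Nat.cast_add]
    exact (cohDim_le_iff _).2
      ((projDimLE_trivialZ_prod_iff G G _).2 (ExtTensor.projDimLE_add hle hle))
  refine le_antisymm hupper ?_
  rw [hn]
  cases n with
  | zero => simp
  | succ n =>
    by_contra hlt
    have hnot : ¬ ProjDimLE (MonoidAlgebra ℤ G) (TrivialZ G) n := fun h ↦ by
      have := (cohDim_le_iff n).2 h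
      rw [hn, Nat.cast_le] at this
      lia
    have hprod : cohDim ℤ (G × G) ≤ (n + n + 1 : ℕ) := by
      refine ENat.lt_natCast_add_one_iff.1 ((not_le.1 hlt).trans_eq ?_)
      norm_cast
      lia
    obtain ⟨K, P, Q, _, _, _, _, _, _, i, p, _, _, _, _, _, hi, hip, hp, hr, h⟩ :=
      hG.exists_syzygy (T := MonoidAlgebra ℤ G) hle hnot
    have hKX := h (TrivialZ G) n hle
      ((projDimLE_trivialZ_prod_iff G G _).1 ((cohDim_le_iff _).1 hprod))
    have hK : ProjDimLE (MonoidAlgebra ℤ G) K 1 :=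
      ProjDimLE.right_of_exact hi hip hp (ProjDimLE.of_projective _) (ProjDimLE.of_projective _)
    exact hr (ExtTensor.exists_retraction hi hip hp
      (h K 0 hK (ExtTensor.projDimLE_swap hKX)))

/-- Main Theorem: For any geometrically finite group `Γ`,
`cd(Γ × Γ) = 2 · cd(Γ)`. -/
theorem stmt15 (Γ : Type) [Group Γ] (hgf : IsGeomFinite Γ) :
    cohDim ℤ (Γ × Γ) = 2 * cohDim ℤ Γ := by
  obtain ⟨N, C, _, _, _, _, hC, d, ε, hε, h₀, h⟩ := hgf
  exact cohDim_prod_self (HasFiniteResolution.of_exact_sequence N C hC d ε hε h₀ h)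
end
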